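/- For every positive integer t there exists a constant d0(t) with the following property: for every tree T on t+1 vertices whose diameter is at least 3 and every finite simple graph G on n vertices with average degree d ≥ d0(t), the number of injective homomorphisms from T to G equals n·d(d−1)···(d−t+1) if and only if every connected component of G is a complete graph on d+1 vertices (in particular d is an integer). -/

import Mathlib

/-- Number of injective graph homomorphisms ("labeled copies") from `T` to `G`. -/
noncomputable def monCount {α β : Type} (T : SimpleGraph α) (G : SimpleGraph β) : ℕ :=
  Nat.card {f : α → β // Function.Injective f ∧ ∀ ⦃u v : α⦄, T.Adj u v → G.Adj (f u) (f v)}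

/-- Average degree `d = 2|E(G)|/n` of a finite graph. -/
noncomputable def avgDeg {β : Type} [Fintype β] (G : SimpleGraph β) : ℝ :=
  2 * (Nat.card G.edgeSet) / (Fintype.card β)

/-- Falling factorial `(x)_t = x(x-1)⋯(x-t+1)` of a real number. -/
noncomputable def fallFact (x : ℝ) (t : ℕ) : ℝ := ∏ i ∈ Finset.range t, (x - (i : ℝ))

/-- `G` is a vertex-disjoint union of complete graphs, each on `m` vertices:
every connected component has `m` vertices and is a clique. -/
def componentsAreCliques {β : Type} (G : SimpleGraph β) (m : ℕ) : Prop :=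
  ∀ c : G.ConnectedComponent, c.supp.ncard = m ∧ c.supp.Pairwise G.Adj



namespace TreeCount
open Finset
open scoped Classical

variable {β : Type} [Fintype β]

noncomputable def nb (G : SimpleGraph β) (v : β) : Finset β := univ.filter (fun u => G.Adj v u)

noncomputable def dg (G : SimpleGraph β) (v : β) : ℝ := ((nb G v).card : ℝ)

/-- available extensions at step k -/
noncomputable def avail (G : SimpleGraph β) (p : ℕ → ℕ) (k : ℕ) (f : ℕ → β) : Finset β :=
  (nb G (f (p k))).filter (fun u => ∀ l < k, f l ≠ u)

noncomputable def av (G : SimpleGraph β) (p : ℕ → ℕ) (k : ℕ) (f : ℕ → β) : ℝ :=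
  ((avail G p k f).card : ℝ)

noncomputable def Op (G : SimpleGraph β) (p : ℕ → ℕ) (w0 : β → ℝ) (w : ℕ → (ℕ → β) → ℝ) :
    ℕ → ((ℕ → β) → ℝ) → ℝ
  | 0, F => ∑ u, w0 u * F (fun _ => u)
  | k + 1, F => Op G p w0 w k
      (fun f => w (k + 1) f * ∑ u ∈ avail G p (k + 1) f, F (Function.update f (k + 1) u))

def Good (G : SimpleGraph β) (p : ℕ → ℕ) (k : ℕ) (f : ℕ → β) : Prop :=
  (∀ i ≤ k, ∀ j ≤ k, f i = f j → i = j) ∧ ∀ i < k, G.Adj (f (p (i + 1))) (f (i + 1))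

/-- used neighbours at step k+1 -/
noncomputable def us (G : SimpleGraph β) (p : ℕ → ℕ) (k : ℕ) (f : ℕ → β) : Finset ℕ :=
  (range (k + 1)).filter (fun l => G.Adj (f (p (k + 1))) (f l))

variable {G : SimpleGraph β} {p : ℕ → ℕ}

lemma good_zero (f : ℕ → β) : Good G p 0 f := by
  constructor
  · intro i hi j hj _; omega
  · intro i hi; omega

lemma good_succ (hp : ∀ k, p (k + 1) ≤ k) {k : ℕ} {f : ℕ → β} (hf : Good G p k f) {u : β}
    (hu : u ∈ avail G p (k + 1) f) : Good G p (k + 1) (Function.update f (k + 1) u) := by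
  simp only [avail, nb, mem_filter, mem_univ, true_and] at hu
  obtain ⟨h1, h2⟩ := hu
  constructor
  · intro i hi j hj hij
    rcases Nat.lt_or_ge i (k+1) with hi' | hi' <;> rcases Nat.lt_or_ge j (k+1) with hj' | hj'
    · rw [Function.update_of_ne (by omega), Function.update_of_ne (by omega)] at hij
      exact hf.1 i (by omega) j (by omega) hij
    · have : j = k + 1 := by omega
      subst this
      rw [Function.update_of_ne (by omega), Function.update_self] at hij
      exact absurd hij (h2 i hi')
    · have : i = k + 1 := by omega
      subst this
      rw [Function.update_self, Function.update_of_ne (by omega)] at hij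
      exact absurd hij.symm (h2 j hj')
    · omega
  · intro i hi
    have hpi := hp i
    rcases Nat.lt_or_ge i k with hi' | hi'
    · rw [Function.update_of_ne (by omega), Function.update_of_ne (by omega)]
      exact hf.2 i hi'
    · have : i = k := by omega
      subst this
      rw [Function.update_of_ne (by omega), Function.update_self]
      exact h1

section op
variable {w0 : β → ℝ} {w : ℕ → (ℕ → β) → ℝ}

lemma op_add (k : ℕ) : ∀ (F F' : (ℕ → β) → ℝ),
    Op G p w0 w k (fun f => F f + F' f) = Op G p w0 w k F + Op G p w0 w k F' := by
  induction k with
  | zero => intro F F'; simp [Op, mul_add, sum_add_distrib]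
  | succ k ih =>
    intro F F'
    simp only [Op]
    rw [← ih]
    congr 1; funext f
    rw [sum_add_distrib]; ring

lemma op_smul (k : ℕ) : ∀ (c : ℝ) (F : (ℕ → β) → ℝ),
    Op G p w0 w k (fun f => c * F f) = c * Op G p w0 w k F := by
  induction k with
  | zero => intro c F; simp only [Op, mul_sum]; apply sum_congr rfl; intros; ring
  | succ k ih =>
    intro c F
    simp only [Op]
    rw [← ih]
    congr 1; funext f
    rw [← mul_sum]; ring

lemma op_sub (k : ℕ) (F F' : (ℕ → β) → ℝ) :
    Op G p w0 w k (fun f => F f - F' f) = Op G p w0 w k F - Op G p w0 w k F' := by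
  have h1 := op_smul (G := G) (p := p) (w0 := w0) (w := w) k (-1) F'
  have h2 := op_add (G := G) (p := p) (w0 := w0) (w := w) k F (fun f => -1 * F' f)
  rw [h1] at h2
  have : (fun f => F f - F' f) = (fun f => F f + -1 * F' f) := by funext f; ring
  rw [this, h2]; ring

lemma op_zero (k : ℕ) : Op G p w0 w k (fun _ => 0) = 0 := by
  have := op_smul (G := G) (p := p) (w0 := w0) (w := w) k 0 (fun _ => 0)
  simpa using this

lemma op_sum {ι : Type} (s : Finset ι) (k : ℕ) (F : ι → (ℕ → β) → ℝ) :
    Op G p w0 w k (fun f => ∑ i ∈ s, F i f) = ∑ i ∈ s, Op G p w0 w k (F i) := by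
  induction s using Finset.induction_on with
  | empty => simpa using op_zero k
  | insert a s ha ih =>
    simp only [sum_insert ha]
    rw [op_add, ih]

lemma op_mono (hp : ∀ k, p (k + 1) ≤ k) (h0 : ∀ u, 0 ≤ w0 u) (hw : ∀ k f, 0 ≤ w k f) (k : ℕ) :
    ∀ (F F' : (ℕ → β) → ℝ), (∀ f, Good G p k f → F f ≤ F' f) →
    Op G p w0 w k F ≤ Op G p w0 w k F' := by
  induction k with
  | zero =>
    intro F F' h
    simp only [Op]
    exact sum_le_sum fun u _ => mul_le_mul_of_nonneg_left (h _ (good_zero _)) (h0 u)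
  | succ k ih =>
    intro F F' h
    simp only [Op]
    apply ih
    intro f hf
    exact mul_le_mul_of_nonneg_left
      (sum_le_sum fun u hu => h _ (good_succ hp hf hu)) (hw _ _)

lemma op_congr (hp : ∀ k, p (k + 1) ≤ k) (k : ℕ) :
    ∀ (F F' : (ℕ → β) → ℝ), (∀ f, Good G p k f → F f = F' f) →
    Op G p w0 w k F = Op G p w0 w k F' := by
  induction k with
  | zero =>
    intro F F' h
    simp only [Op]
    exact sum_congr rfl fun u _ => by rw [h _ (good_zero _)]
  | succ k ih =>
    intro F F' h
    simp only [Op]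
    apply ih
    intro f hf
    rw [sum_congr rfl fun u hu => h _ (good_succ hp hf hu)]

end op

lemma us_subset (hp : ∀ k, p (k + 1) ≤ k) (k : ℕ) (f : ℕ → β) :
    us G p k f ⊆ (range (k + 1)).erase (p (k + 1)) := by
  intro l hl
  simp only [us, mem_filter] at hl
  rw [mem_erase]
  refine ⟨?_, hl.1⟩
  rintro rfl
  exact G.irrefl hl.2

lemma us_card (hp : ∀ k, p (k + 1) ≤ k) (k : ℕ) (f : ℕ → β) : (us G p k f).card ≤ k := by
  have := card_le_card (us_subset (G := G) hp k f)
  rw [card_erase_of_mem (mem_range.2 (by have := hp k; omega)), card_range] at this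
  simpa using this

lemma avail_sum {k : ℕ} {f : ℕ → β} (hf : Good G p k f) (h : β → ℝ) :
    ∑ u ∈ avail G p (k + 1) f, h u =
      ∑ u ∈ nb G (f (p (k + 1))), h u - ∑ l ∈ us G p k f, h (f l) := by
  have h1 : ∑ l ∈ us G p k f, h (f l) = ∑ u ∈ (us G p k f).image f, h u := by
    rw [sum_image]
    intro i hi j hj hij
    simp only [us, coe_filter, mem_range, Set.mem_ofPred_eq] at hi hj
    exact hf.1 i (by omega) j (by omega) hij
  have h2 : avail G p (k + 1) f = nb G (f (p (k + 1))) \ (us G p k f).image f := by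
    ext u
    simp only [avail, us, mem_filter, mem_sdiff, mem_image, mem_range, not_exists, not_and, nb,
      mem_univ, true_and]
    constructor
    · rintro ⟨a, b⟩
      exact ⟨a, fun l hl => b l hl.1⟩
    · rintro ⟨a, b⟩
      refine ⟨a, fun l hl hlu => b l ⟨hl, ?_⟩ hlu⟩
      rw [hlu]; exact a
  have h3 : (us G p k f).image f ⊆ nb G (f (p (k + 1))) := by
    intro u hu
    simp only [us, mem_image, mem_filter] at hu
    obtain ⟨l, hl, rfl⟩ := hu
    simp [nb, hl.2]
  rw [h1, h2, ← sum_sdiff h3]; ring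

lemma av_eq {k : ℕ} {f : ℕ → β} (hf : Good G p k f) :
    av G p (k + 1) f = dg G (f (p (k + 1))) - ((us G p k f).card : ℝ) := by
  have := avail_sum hf (fun _ => 1)
  simpa [av, dg] using this

lemma av_congr (hp : ∀ k, p (k + 1) ≤ k) {k : ℕ} {f f' : ℕ → β} (h : ∀ l ≤ k, f l = f' l) :
    av G p (k + 1) f = av G p (k + 1) f' := by
  have : avail G p (k + 1) f = avail G p (k + 1) f' := by
    unfold avail
    rw [h _ (hp k)]
    apply filter_congr
    intro u _
    constructor
    · intro h1 l hl; rw [← h l (by omega)]; exact h1 l hl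
    · intro h1 l hl; rw [h l (by omega)]; exact h1 l hl
  unfold av; rw [this]

/-- the random embedding expectation -/
noncomputable def Ex (G : SimpleGraph β) (p : ℕ → ℕ) : ℕ → ((ℕ → β) → ℝ) → ℝ :=
  Op G p (fun u => dg G u / ∑ v, dg G v) (fun k f => (av G p k f)⁻¹)

noncomputable def Nx (G : SimpleGraph β) (p : ℕ → ℕ) : ℕ → ((ℕ → β) → ℝ) → ℝ :=
  Op G p (fun _ => 1) (fun _ _ => 1)

noncomputable def Piw (G : SimpleGraph β) (h : β → ℝ) : ℝ := (∑ v, dg G v * h v) / ∑ v, dg G v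

noncomputable def Av (G : SimpleGraph β) (h : β → ℝ) (v : β) : ℝ := (∑ u ∈ nb G v, h u) / dg G v

structure Hyp (t : ℕ) (d : ℝ) (G : SimpleGraph β) (p : ℕ → ℕ) : Prop where
  hp : ∀ k, p (k + 1) ≤ k
  hd : 16 * ((t : ℝ) + 1) ≤ d
  hmin : ∀ v, d / 4 ≤ dg G v
  hM : ∑ v, dg G v = (Fintype.card β : ℝ) * d
  hn : 0 < Fintype.card β

variable {t : ℕ} {d : ℝ}

lemma dg_nonneg (v : β) : 0 ≤ dg G v := by unfold dg; positivity

lemma Hyp.dpos (H : Hyp t d G p) : 16 ≤ d := by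
  have := H.hd
  have : (0:ℝ) ≤ t := by positivity
  linarith

lemma Hyp.dgpos (H : Hyp t d G p) (v : β) : 4 * ((t : ℝ) + 1) ≤ dg G v := by
  have := H.hd
  have := H.hmin v
  linarith

lemma Hyp.dgpos' (H : Hyp t d G p) (v : β) : 0 < dg G v := by
  have := H.dgpos v
  have : (0:ℝ) ≤ t := by positivity
  linarith

lemma Hyp.Mpos (H : Hyp t d G p) : 0 < ∑ v, dg G v := by
  rw [H.hM]
  have := H.hn
  have := H.dpos
  positivity

lemma Hyp.av_ge (H : Hyp t d G p) {k : ℕ} (hk : k ≤ t) {f : ℕ → β} (hf : Good G p k f) :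
    dg G (f (p (k + 1))) / 2 ≤ av G p (k + 1) f := by
  rw [av_eq hf]
  have h1 : ((us G p k f).card : ℝ) ≤ t := by exact_mod_cast (us_card H.hp k f).trans hk
  have h2 := H.dgpos (f (p (k + 1)))
  have : (0:ℝ) ≤ t := by positivity
  linarith

lemma Hyp.av_pos (H : Hyp t d G p) {k : ℕ} (hk : k ≤ t) {f : ℕ → β} (hf : Good G p k f) :
    0 < av G p (k + 1) f := by
  have := H.av_ge hk hf
  have := H.dgpos' (f (p (k + 1)))
  linarith

lemma Hyp.ex_mono (H : Hyp t d G p) (k : ℕ) (F F' : (ℕ → β) → ℝ)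
    (h : ∀ f, Good G p k f → F f ≤ F' f) : Ex G p k F ≤ Ex G p k F' := by
  apply op_mono H.hp _ _ k F F' h
  · intro u; exact div_nonneg (dg_nonneg _) H.Mpos.le
  · intro k f; exact inv_nonneg.2 (by unfold av; positivity)

lemma Hyp.ex_step (H : Hyp t d G p) {k : ℕ} (hk : k ≤ t) (F : (ℕ → β) → ℝ)
    (hF : ∀ f u, F (Function.update f (k + 1) u) = F f) : Ex G p (k + 1) F = Ex G p k F := by
  show Op G p _ _ (k+1) F = _
  simp only [Op]
  apply op_congr H.hp
  intro f hf
  simp only [hF, sum_const, nsmul_eq_mul]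
  have := H.av_pos hk hf
  change (av G p (k + 1) f)⁻¹ * (av G p (k + 1) f * F f) = F f
  field_simp

lemma Hyp.ex_down (H : Hyp t d G p) {j k : ℕ} (hjk : j ≤ k) (hk : k ≤ t) (F : (ℕ → β) → ℝ)
    (hF : ∀ f i u, j < i → F (Function.update f i u) = F f) : Ex G p k F = Ex G p j F := by
  induction k, hjk using Nat.le_induction with
  | base => rfl
  | succ k hjk ih =>
    rw [H.ex_step (by omega) F (fun f u => hF f _ u (by omega)), ih (by omega)]

lemma Hyp.ex_one (H : Hyp t d G p) {k : ℕ} (hk : k ≤ t) : Ex G p k (fun _ => 1) = 1 := by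
  rw [H.ex_down (j := 0) (Nat.zero_le _) hk _ (fun _ _ _ _ => rfl)]
  simp only [Ex, Op, mul_one]
  rw [← sum_div]
  exact div_self H.Mpos.ne'

lemma ex_zero_eq (h : β → ℝ) : Ex G p 0 (fun f => h (f 0)) = Piw G h := by
  simp only [Ex, Op, Piw]
  rw [sum_div]
  apply sum_congr rfl
  intro u _; ring

lemma Hyp.ex_nx (H : Hyp t d G p) {k : ℕ} (hk : k ≤ t) : ∀ (F : (ℕ → β) → ℝ),
    (∑ v, dg G v) * Ex G p k (fun f => F f * ((∏ i ∈ range k, av G p (i + 1) f) / dg G (f 0)))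
      = Nx G p k F := by
  induction k with
  | zero =>
    intro F
    simp only [Ex, Nx, Op, range_zero, prod_empty]
    rw [mul_sum]
    apply sum_congr rfl
    intro u _
    have := H.Mpos.ne'
    have := (H.dgpos' u).ne'
    field_simp
  | succ k ih =>
    intro F
    have hR : Nx G p (k + 1) F = Nx G p k (fun f => 1 * ∑ u ∈ avail G p (k + 1) f,
      F (Function.update f (k + 1) u)) := rfl
    rw [hR, ← ih (by omega)]
    congr 1
    show Op G p _ _ (k+1) _ = _
    simp only [Op]
    apply op_congr H.hp
    intro f hf
    have h1 : ∀ u, (∏ i ∈ range (k + 1), av G p (i + 1) (Function.update f (k + 1) u))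
        = ∏ i ∈ range (k + 1), av G p (i + 1) f := by
      intro u
      apply prod_congr rfl
      intro i hi
      rw [mem_range] at hi
      apply av_congr H.hp
      intro l hl
      rw [Function.update_of_ne (by omega)]
    have h2 : ∀ u, Function.update f (k + 1) u 0 = f 0 := fun u => by
      rw [Function.update_of_ne (by omega)]
    simp only [h1, h2]
    rw [← sum_mul, prod_range_succ]
    have := (H.av_pos (by omega : k ≤ t) hf).ne'
    field_simp

lemma Hyp.pi_Av (H : Hyp t d G p) (h : β → ℝ) : Piw G (Av G h) = Piw G h := by
  unfold Piw Av
  congr 1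
  have : ∀ v, dg G v * ((∑ u ∈ nb G v, h u) / dg G v) = ∑ u, if G.Adj v u then h u else 0 := by
    intro v
    rw [mul_div_cancel₀ _ (H.dgpos' v).ne', nb, sum_filter]
  simp only [this]
  rw [sum_comm]
  apply sum_congr rfl
  intro u _
  have h2 : ∀ x, (if G.Adj x u then h u else 0) = if G.Adj u x then h u else 0 := by
    intro x; simp only [G.adj_comm]
  simp only [h2]
  rw [← sum_filter, sum_const, nsmul_eq_mul]
  rfl

lemma Hyp.pi_mono (H : Hyp t d G p) (h h' : β → ℝ) (hh : ∀ v, h v ≤ h' v) :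
    Piw G h ≤ Piw G h' := by
  unfold Piw
  apply div_le_div_of_nonneg_right _ H.Mpos.le
  exact sum_le_sum fun v _ => mul_le_mul_of_nonneg_left (hh v) (dg_nonneg v)

lemma Hyp.pi_Av_sq (H : Hyp t d G p) (h : β → ℝ) :
    Piw G (fun v => (Av G h v) ^ 2) ≤ Piw G (fun v => h v ^ 2) := by
  rw [← H.pi_Av (fun v => h v ^ 2)]
  apply H.pi_mono
  intro v
  unfold Av
  have h1 := sq_sum_le_card_mul_sum_sq (s := nb G v) (f := h)
  have h2 := H.dgpos' v
  change (∑ u ∈ nb G v, h u) ^ 2 ≤ dg G v * _ at h1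
  rw [div_pow, div_le_div_iff₀ (by positivity) h2]
  nlinarith [mul_le_mul_of_nonneg_right h1 h2.le]

lemma Hyp.dom (H : Hyp t d G p) (j : ℕ) : j ≤ t → ∀ (h : β → ℝ), (∀ v, 0 ≤ h v) →
    Ex G p j (fun f => h (f j)) ≤ 2 ^ j * Piw G h := by
  induction j using Nat.strong_induction_on with
  | _ j ih =>
    intro hj h hh
    rcases j with _ | k
    · rw [ex_zero_eq]; simp
    · have hA : ∀ v, 0 ≤ Av G h v := fun v =>
        div_nonneg (sum_nonneg fun u _ => hh u) (dg_nonneg v)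
      have hpk := H.hp k
      have h1 : Ex G p (k + 1) (fun f => h (f (k + 1))) ≤
          Ex G p k (fun f => 2 * Av G h (f (p (k + 1)))) := by
        show Op G p _ _ (k+1) _ ≤ _
        simp only [Op]
        apply H.ex_mono
        intro f hf
        simp only [Function.update_self]
        rw [avail_sum hf, inv_mul_le_iff₀ (H.av_pos (by omega) hf)]
        have h2 := H.av_ge (by omega : k ≤ t) hf
        have h3 := H.dgpos' (f (p (k + 1)))
        have h4 : ∑ u ∈ nb G (f (p (k + 1))), h u = dg G (f (p (k + 1))) * Av G h (f (p (k + 1))) := by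
          unfold Av; field_simp
        have h5 : 0 ≤ ∑ l ∈ us G p k f, h (f l) := sum_nonneg fun l _ => hh _
        rw [h4]
        nlinarith [mul_le_mul_of_nonneg_right h2 (hA (f (p (k + 1))))]
      have h2 : Ex G p k (fun f => 2 * Av G h (f (p (k + 1)))) =
          2 * Ex G p (p (k + 1)) (fun f => Av G h (f (p (k + 1)))) := by
        rw [← H.ex_down hpk (by omega)]
        · exact op_smul k 2 _
        · intro f i u hi; rw [Function.update_of_ne (by omega)]
      have h3 := ih (p (k + 1)) (by omega) (by omega) (Av G h) hA
      rw [H.pi_Av] at h3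
      have h4 : 0 ≤ Piw G h := div_nonneg
        (sum_nonneg fun v _ => mul_nonneg (dg_nonneg v) (hh v)) H.Mpos.le
      have h5 : (2:ℝ) ^ (p (k + 1)) ≤ 2 ^ k := pow_le_pow_right₀ (by norm_num) hpk
      rw [h2] at h1
      rw [pow_succ]
      nlinarith [mul_le_mul_of_nonneg_right h5 h4]

end TreeCount

namespace TreeCount
open Finset
open scoped Classical

variable {β : Type} [Fintype β]
variable {G : SimpleGraph β} {p : ℕ → ℕ}
variable {t : ℕ} {d : ℝ}

noncomputable def yy (d : ℝ) (G : SimpleGraph β) (v : β) : ℝ := 1 - d / dg G v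

noncomputable def df (G : SimpleGraph β) (p : ℕ → ℕ) (k : ℕ) (f : ℕ → β) : ℝ :=
  if (us G p k f).card < k then 1 else 0

noncomputable def Gm (G : SimpleGraph β) (p : ℕ → ℕ) (k : ℕ) : ℝ :=
  Ex G p k (fun f => df G p k f / dg G (f (p (k + 1))))

noncomputable def Rr (d : ℝ) (G : SimpleGraph β) : ℝ := Piw G (fun v => yy d G v ^ 2)

lemma coef (t dv d s m x : ℝ) (ht : 0 ≤ t) (h1 : 4 * (t + 1) ≤ dv) (h2 : 16 * (t + 1) ≤ d)
    (hs0 : 0 ≤ s) (hs : s ≤ m) (hm : m ≤ t) (hx0 : 0 ≤ x) (hx1 : x ≤ 1) (e : ℝ)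
    (he : (s = m ∧ x = 1 ∧ e = 0) ∨ e = 1) :
    |x / (dv - s) - 1 / (d - m)| ≤ 4 * (e / dv + |1 - d / dv| / d) := by
  have hdv : 0 < dv := by linarith
  have hd : 0 < d := by linarith
  have a1 : dv / 2 ≤ dv - s := by linarith
  have a2 : d / 2 ≤ d - m := by linarith
  have a3 : dv / 2 ≤ dv - m := by linarith
  rcases he with ⟨rfl, rfl, rfl⟩ | rfl
  · have e1 : 1 / (dv - s) - 1 / (d - s) = (d - dv) / ((dv - s) * (d - s)) := by
      have : dv - s ≠ 0 := by linarith
      have : d - s ≠ 0 := by linarith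
      field_simp; ring
    have e2 : 4 * (0 / dv + |1 - d / dv| / d) = |d - dv| / (dv / 2 * (d / 2)) := by
      have : 1 - d / dv = (dv - d) / dv := by field_simp
      rw [this, abs_div, abs_of_pos hdv, abs_sub_comm]
      field_simp; ring
    rw [e1, e2, abs_div, abs_of_pos (by apply mul_pos <;> linarith : 0 < (dv - s) * (d - s))]
    apply div_le_div_of_nonneg_left (abs_nonneg _) (by positivity)
    exact mul_le_mul a1 a2 (by positivity) (by linarith)
  · have b1 : x / (dv - s) ≤ 2 / dv := by
      rw [div_le_div_iff₀ (by linarith) hdv]; nlinarith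
    have b2 : 0 ≤ x / (dv - s) := div_nonneg hx0 (by linarith)
    have b3 : 1 / (d - m) ≤ 2 / d := by
      rw [div_le_div_iff₀ (by linarith) hd]; nlinarith
    have b4 : 0 ≤ 1 / (d - m) := div_nonneg zero_le_one (by linarith)
    have b5 : 2 / d = 2 * (1 / dv) + 2 * ((1 - d / dv) / d) := by field_simp; ring
    have b6 : (1 - d / dv) / d ≤ |1 - d / dv| / d :=
      div_le_div_of_nonneg_right (le_abs_self _) hd.le
    have b7 : 0 ≤ |1 - d / dv| / d := by positivity
    have b8 : 0 ≤ 1 / dv := by positivity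
    have b9 : 2 / dv = 2 * (1 / dv) := by ring
    rw [abs_le]
    constructor <;> linarith

lemma Hyp.coef_us (H : Hyp t d G p) {k : ℕ} (hk : k ≤ t) (f : ℕ → β) {l : ℕ}
    (hl : l ∈ (range (k + 1)).erase (p (k + 1))) :
    |(if l ∈ us G p k f then 1 else 0) / (dg G (f (p (k + 1))) - ((us G p k f).card : ℝ))
      - 1 / (d - k)| ≤ 4 * (df G p k f / dg G (f (p (k + 1))) +
        |yy d G (f (p (k + 1)))| / d) := by
  have hc := us_card (G := G) H.hp k f
  unfold yy
  apply coef t _ _ _ _ _ (by positivity) (H.dgpos _) H.hd (by positivity) (by exact_mod_cast hc)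
    (by exact_mod_cast hk)
  · split_ifs <;> norm_num
  · split_ifs <;> norm_num
  · unfold df
    rcases hc.lt_or_eq with h | h
    · right; rw [if_pos h]
    · left
      refine ⟨by exact_mod_cast h, ?_, ?_⟩
      · have : us G p k f = (range (k + 1)).erase (p (k + 1)) := by
          apply eq_of_subset_of_card_le (us_subset H.hp k f)
          rw [card_erase_of_mem (mem_range.2 (by have := H.hp k; omega)), card_range, h]
          simp
        rw [this, if_pos hl]
      · rw [if_neg (by omega)]

/-- pointwise error bound -/
lemma Hyp.err (H : Hyp t d G p) {k : ℕ} (hk : k ≤ t) {f : ℕ → β} (hf : Good G p k f)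
    (h : β → ℝ) {η : ℝ} (h0 : 0 < η) (h1 : η ≤ 1) :
    |(av G p (k + 1) f)⁻¹ * ∑ u ∈ avail G p (k + 1) f, h u - Av G h (f (p (k + 1)))
      - ∑ l ∈ (range (k + 1)).erase (p (k + 1)),
        (1 / (d - k)) * (Av G h (f (p (k + 1))) - h (f l))| ≤
    ∑ l ∈ (range (k + 1)).erase (p (k + 1)), (4 * η * (df G p k f / dg G (f (p (k + 1)))) +
      (1 / (η * d)) * (40 * Av G h (f (p (k + 1))) ^ 2 + 40 * h (f l) ^ 2 +
        4 * yy d G (f (p (k + 1))) ^ 2)) := by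
  set v := f (p (k + 1)) with hv
  set L := (range (k + 1)).erase (p (k + 1)) with hL
  set a := Av G h v with ha
  have hpos := H.av_pos hk hf
  have hdg := H.dgpos' v
  have hd := H.dpos
  have hnb : ∑ u ∈ nb G v, h u = dg G v * a := by rw [ha]; unfold Av; field_simp
  have hav := av_eq hf
  rw [← hv] at hav
  have e1 : (av G p (k + 1) f)⁻¹ * ∑ u ∈ avail G p (k + 1) f, h u - a
      = ∑ l ∈ L, (if l ∈ us G p k f then 1 else 0) / (dg G v - ((us G p k f).card : ℝ))
        * (a - h (f l)) := by
    rw [← hav]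
    have e2 : ∑ l ∈ L, (if l ∈ us G p k f then (1:ℝ) else 0) / (av G p (k + 1) f) * (a - h (f l))
        = (av G p (k + 1) f)⁻¹ * ∑ l ∈ us G p k f, (a - h (f l)) := by
      rw [mul_sum, ← sum_subset (us_subset H.hp k f)]
      · apply sum_congr rfl
        intro l hl; rw [if_pos hl]; ring
      · intro l _ hl; rw [if_neg hl]; ring
    rw [e2, avail_sum hf, ← hv, hnb, sum_sub_distrib, sum_const, nsmul_eq_mul]
    have : dg G v = av G p (k + 1) f + ((us G p k f).card : ℝ) := by linarith
    rw [this]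
    field_simp
    ring
  rw [e1, ← sum_sub_distrib]
  refine (abs_sum_le_sum_abs _ _).trans (sum_le_sum fun l hl => ?_)
  rw [← sub_mul, abs_mul]
  have hc := H.coef_us hk f hl
  rw [← hv] at hc
  refine (mul_le_mul_of_nonneg_right hc (abs_nonneg _)).trans ?_
  set D := a - h (f l) with hD
  set y := yy d G v
  set e := df G p k f with he
  have he0 : 0 ≤ e := by rw [he]; unfold df; split_ifs <;> norm_num
  have he1 : e ≤ 1 := by rw [he]; unfold df; split_ifs <;> norm_num
  have hDD : D ^ 2 ≤ 2 * a ^ 2 + 2 * h (f l) ^ 2 := by rw [hD]; nlinarith [sq_nonneg (a + h (f l))]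
  have i1 : |D| ≤ η + D ^ 2 / η := by
    rw [← sq_abs D, ← sub_le_iff_le_add', le_div_iff₀ h0]
    nlinarith [sq_nonneg (|D| - η), abs_nonneg D]
  have hmin := H.hmin v
  have i2 : e / dg G v ≤ 4 / d := by
    rw [div_le_div_iff₀ hdg (by linarith)]; nlinarith
  have i3 : e / dg G v * |D| ≤ η * (e / dg G v) + 4 * (1 / (η * d)) * D ^ 2 := by
    have j0 : 0 ≤ e / dg G v := by positivity
    have j1 := mul_le_mul_of_nonneg_left i1 j0
    have j2 := mul_le_mul_of_nonneg_right i2 (by positivity : 0 ≤ D ^ 2 / η)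
    have j3 : 4 / d * (D ^ 2 / η) = 4 * (1 / (η * d)) * D ^ 2 := by field_simp
    nlinarith
  have i4 : |y| / d * |D| ≤ (1 / (η * d)) * (y ^ 2 + D ^ 2) := by
    have j1 : |y| / d * |D| ≤ (1 / d) * (y ^ 2 + D ^ 2) := by
      have : |y| / d * |D| = (1 / d) * (|y| * |D|) := by ring
      rw [this]
      apply mul_le_mul_of_nonneg_left _ (by positivity)
      rw [← sq_abs y, ← sq_abs D]
      nlinarith [sq_nonneg (|y| - |D|), abs_nonneg y, abs_nonneg D]
    refine j1.trans (mul_le_mul_of_nonneg_right ?_ (by positivity))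
    apply one_div_le_one_div_of_le (by positivity)
    nlinarith
  have hq : 0 ≤ 1 / (η * d) := by positivity
  have i5 := mul_le_mul_of_nonneg_left hDD hq
  nlinarith

noncomputable def Kc (t : ℕ) : ℕ → ℝ
  | 0 => 0
  | j + 1 => (1 + 2 * t) * Kc t j + 84 * t * 2 ^ t

lemma Kc_nonneg (t j : ℕ) : 0 ≤ Kc t j := by
  induction j with
  | zero => simp [Kc]
  | succ j ih => simp only [Kc]; positivity

lemma Kc_mono (t : ℕ) : Monotone (Kc t) := by
  apply monotone_nat_of_le_succ
  intro j
  simp only [Kc]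
  have := Kc_nonneg t j
  have h : 0 ≤ 84 * (t:ℝ) * 2 ^ t := by positivity
  have : 0 ≤ (t:ℝ) * Kc t j := by positivity
  nlinarith

lemma Hyp.ex_coord (H : Hyp t d G p) {j k : ℕ} (hjk : j ≤ k) (hk : k ≤ t) (h : β → ℝ) :
    Ex G p k (fun f => h (f j)) = Ex G p j (fun f => h (f j)) := by
  apply H.ex_down hjk hk
  intro f i u hi
  rw [Function.update_of_ne (by omega)]

lemma Hyp.Gm_nonneg (H : Hyp t d G p) (k : ℕ) : 0 ≤ Gm G p k := by
  have := H.ex_mono k (fun _ => 0) (fun f => df G p k f / dg G (f (p (k + 1)))) (by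
    intro f _
    apply div_nonneg _ (dg_nonneg _)
    unfold df; split_ifs <;> norm_num)
  rw [show Ex G p k (fun _ => 0) = 0 from op_zero k] at this
  exact this

lemma Hyp.Rr_nonneg (H : Hyp t d G p) : 0 ≤ Rr d G :=
  div_nonneg (sum_nonneg fun v _ => mul_nonneg (dg_nonneg v) (sq_nonneg _)) H.Mpos.le

lemma Hyp.main_err (H : Hyp t d G p) {η : ℝ} (h0 : 0 < η) (h1 : η ≤ 1) (j : ℕ) :
    j ≤ t → ∀ h : β → ℝ, Piw G h = 0 → Piw G (fun v => h v ^ 2) ≤ Rr d G →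
    |Ex G p j (fun f => h (f j))| ≤
      Kc t j * (η * (∑ k ∈ range t, Gm G p k) + (1 / (η * d)) * Rr d G) := by
  induction j using Nat.strong_induction_on with
  | _ j ih =>
    intro hj h hh0 hh2
    rcases j with _ | k
    · rw [ex_zero_eq, hh0]; simp [Kc]
    set ε := η * (∑ k ∈ range t, Gm G p k) + (1 / (η * d)) * Rr d G with hε
    have hd := H.dpos
    have hR := H.Rr_nonneg
    have hG : ∀ k, 0 ≤ Gm G p k := H.Gm_nonneg
    have hGk : Gm G p k ≤ ∑ k ∈ range t, Gm G p k :=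
      single_le_sum (f := fun k => Gm G p k) (fun i _ => hG i) (mem_range.2 (by omega))
    have hq : 0 ≤ 1 / (η * d) := by positivity
    have hε0 : 0 ≤ ε := by
      have := sum_nonneg (s := range t) (fun i _ => hG i)
      positivity
    have hpk := H.hp k
    have hkt : k ≤ t := by omega
    set L := (range (k + 1)).erase (p (k + 1)) with hL
    have hLc : (L.card : ℝ) ≤ t := by
      rw [hL, card_erase_of_mem (mem_range.2 (by omega)), card_range]
      simpa using hkt
    have hLm : ∀ l ∈ L, l ≤ k := by
      intro l hl
      rw [hL, mem_erase, mem_range] at hl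
      omega
    -- bounds for the averages
    have hA0 : Piw G (Av G h) = 0 := by rw [H.pi_Av, hh0]
    have hA2 : Piw G (fun v => Av G h v ^ 2) ≤ Rr d G := (H.pi_Av_sq h).trans hh2
    have bA : |Ex G p k (fun f => Av G h (f (p (k + 1))))| ≤ Kc t k * ε := by
      rw [H.ex_coord hpk hkt]
      exact (ih _ (by omega) (by omega) _ hA0 hA2).trans
        (mul_le_mul_of_nonneg_right (Kc_mono t hpk) hε0)
    have bh : ∀ l ≤ k, |Ex G p k (fun f => h (f l))| ≤ Kc t k * ε := by
      intro l hl
      rw [H.ex_coord hl hkt]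
      exact (ih _ (by omega) (by omega) _ hh0 hh2).trans
        (mul_le_mul_of_nonneg_right (Kc_mono t hl) hε0)
    have b2 : ∀ (g : β → ℝ), Piw G (fun v => g v ^ 2) ≤ Rr d G → ∀ l ≤ k,
        Ex G p k (fun f => g (f l) ^ 2) ≤ 2 ^ t * Rr d G := by
      intro g hg l hl
      rw [H.ex_coord hl hkt (fun v => g v ^ 2)]
      refine (H.dom l (by omega) (fun v => g v ^ 2) (fun v => sq_nonneg _)).trans ?_
      refine mul_le_mul (pow_le_pow_right₀ (by norm_num) (by omega)) hg ?_ (by positivity)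
      exact div_nonneg (sum_nonneg fun v _ => mul_nonneg (dg_nonneg v) (sq_nonneg _)) H.Mpos.le
    -- the main terms
    set F1 : (ℕ → β) → ℝ := fun f => (av G p (k + 1) f)⁻¹ * ∑ u ∈ avail G p (k + 1) f, h u with hF1
    set F2 : (ℕ → β) → ℝ := fun f => Av G h (f (p (k + 1))) with hF2
    set F3 : (ℕ → β) → ℝ := fun f => ∑ l ∈ L, (1 / (d - k)) * (Av G h (f (p (k + 1))) - h (f l))
      with hF3
    set F4 : (ℕ → β) → ℝ := fun f => ∑ l ∈ L, (4 * η * (df G p k f / dg G (f (p (k + 1)))) +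
      (1 / (η * d)) * (40 * Av G h (f (p (k + 1))) ^ 2 + 40 * h (f l) ^ 2 +
        4 * yy d G (f (p (k + 1))) ^ 2)) with hF4
    have hE1 : Ex G p (k + 1) (fun f => h (f (k + 1))) = Ex G p k F1 := by
      show Op G p _ _ (k+1) _ = _
      simp only [Op, Function.update_self]
      rfl
    have hpt : ∀ f, Good G p k f → |F1 f - F2 f - F3 f| ≤ F4 f := fun f hf => H.err hkt hf h h0 h1
    have u1 : Ex G p k F1 - Ex G p k F2 - Ex G p k F3 ≤ Ex G p k F4 := by
      have : Ex G p k (fun f => (fun f => F1 f - F2 f) f - F3 f) ≤ Ex G p k F4 :=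
        H.ex_mono k _ _ fun f hf => (abs_le.1 (hpt f hf)).2
      unfold Ex at this ⊢
      rw [op_sub, op_sub] at this
      exact this
    have u2 : -Ex G p k F4 ≤ Ex G p k F1 - Ex G p k F2 - Ex G p k F3 := by
      have : Ex G p k (fun f => -1 * F4 f) ≤ Ex G p k (fun f => (fun f => F1 f - F2 f) f - F3 f) :=
        H.ex_mono k _ _ fun f hf => by have := (abs_le.1 (hpt f hf)).1; simp only; linarith
      unfold Ex at this ⊢
      rw [op_sub, op_sub, op_smul] at this
      linarith
    have u3 : Ex G p k F4 ≤ 84 * t * 2 ^ t * ε := by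
      have e1 : Ex G p k F4 = ∑ l ∈ L, (4 * η * Gm G p k + (1 / (η * d)) *
          (40 * Ex G p k (fun f => Av G h (f (p (k + 1))) ^ 2) + 40 * Ex G p k (fun f => h (f l) ^ 2)
            + 4 * Ex G p k (fun f => yy d G (f (p (k + 1))) ^ 2))) := by
        rw [hF4]
        unfold Gm Ex
        rw [op_sum]
        apply sum_congr rfl
        intro l _
        rw [op_add, op_smul, op_smul, op_add, op_add, op_smul, op_smul, op_smul]
      have e2 : ∀ l ∈ L, (4 * η * Gm G p k + (1 / (η * d)) *
          (40 * Ex G p k (fun f => Av G h (f (p (k + 1))) ^ 2) + 40 * Ex G p k (fun f => h (f l) ^ 2)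
            + 4 * Ex G p k (fun f => yy d G (f (p (k + 1))) ^ 2))) ≤ 84 * 2 ^ t * ε := by
        intro l hl
        have c1 := b2 _ hA2 _ hpk
        have c2 := b2 _ hh2 _ (hLm l hl)
        have c3 := b2 (yy d G) le_rfl _ hpk
        have c4 : 40 * Ex G p k (fun f => Av G h (f (p (k + 1))) ^ 2) + 40 * Ex G p k (fun f => h (f l) ^ 2)
            + 4 * Ex G p k (fun f => yy d G (f (p (k + 1))) ^ 2) ≤ 84 * 2 ^ t * Rr d G := by linarith
        have c5 := mul_le_mul_of_nonneg_left c4 hq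
        have c6 : (1:ℝ) ≤ 2 ^ t := one_le_pow₀ (by norm_num)
        have c7 : 4 * η * Gm G p k ≤ 84 * 2 ^ t * (η * ∑ k ∈ range t, Gm G p k) := by
          have := mul_le_mul_of_nonneg_left hGk h0.le
          have c8 : 0 ≤ η * Gm G p k := mul_nonneg h0.le (hG k)
          nlinarith
        rw [hε]
        nlinarith
      rw [e1]
      refine (sum_le_sum e2).trans ?_
      rw [sum_const, nsmul_eq_mul]
      have : 0 ≤ 84 * 2 ^ t * ε := by positivity
      nlinarith
    have u4 : |Ex G p k F3| ≤ 2 * t * Kc t k * ε := by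
      have e1 : Ex G p k F3 = ∑ l ∈ L, (1 / (d - k)) *
          (Ex G p k (fun f => Av G h (f (p (k + 1)))) - Ex G p k (fun f => h (f l))) := by
        rw [hF3]
        unfold Ex
        rw [op_sum]
        apply sum_congr rfl
        intro l _
        rw [op_smul, op_sub]
      rw [e1]
      refine (abs_sum_le_sum_abs _ _).trans ?_
      have e2 : ∀ l ∈ L, |(1 / (d - k)) *
          (Ex G p k (fun f => Av G h (f (p (k + 1)))) - Ex G p k (fun f => h (f l)))| ≤
          2 * Kc t k * ε := by
        intro l hl
        rw [abs_mul]
        have c1 : |1 / (d - k)| ≤ 1 := by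
          have c2 := H.hd
          have c3 : (k:ℝ) ≤ t := by exact_mod_cast hkt
          have c4 : (0:ℝ) ≤ k := by positivity
          rw [abs_of_nonneg (div_nonneg zero_le_one (by linarith)), div_le_one (by linarith)]
          linarith
        have c2 := abs_sub (Ex G p k (fun f => Av G h (f (p (k + 1))))) (Ex G p k (fun f => h (f l)))
        have c3 := bh l (hLm l hl)
        have c4 : |Ex G p k (fun f => Av G h (f (p (k + 1)))) - Ex G p k (fun f => h (f l))|
          ≤ 2 * Kc t k * ε := by linarith
        calc _ ≤ 1 * _ := mul_le_mul_of_nonneg_right c1 (abs_nonneg _)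
          _ ≤ _ := by linarith
      refine (sum_le_sum e2).trans ?_
      rw [sum_const, nsmul_eq_mul]
      have := Kc_nonneg t k
      have : 0 ≤ 2 * Kc t k * ε := by positivity
      nlinarith
    rw [hE1]
    simp only [Kc]
    rw [abs_le] at bA u4 ⊢
    constructor <;> nlinarith [bA.1, bA.2, u4.1, u4.2]

end TreeCount

namespace TreeCount
open Finset
open scoped Classical

variable {β : Type} [Fintype β]
variable {G : SimpleGraph β} {p : ℕ → ℕ}
variable {t : ℕ} {d : ℝ}

lemma log_ub (z : ℝ) (hz : 0 < z) (hz4 : z ≤ 4) :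
    Real.log z ≤ (z - 1) - (z - 1) ^ 2 / 16 := by
  have hs := Real.sqrt_pos.2 hz
  have hss := Real.sq_sqrt hz.le
  have hs2 : Real.sqrt z ≤ 2 := by
    rw [show (2:ℝ) = Real.sqrt 4 by rw [show (4:ℝ) = 2 ^ 2 by norm_num, Real.sqrt_sq (by norm_num)]]
    exact Real.sqrt_le_sqrt hz4
  set s := Real.sqrt z with hsdef
  have h1 : Real.log z = 2 * Real.log s := by
    rw [← hss, Real.log_pow]; norm_num
  have h2 := Real.log_le_sub_one_of_pos hs
  rw [h1, ← hss]
  have h3 : (s + 1) ^ 2 ≤ 16 := by nlinarith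
  nlinarith [mul_le_mul_of_nonneg_left h3 (sq_nonneg (s - 1))]

lemma log_lb (x : ℝ) (h1 : -(1/2) ≤ x) : x - 2 * x ^ 2 ≤ Real.log (1 + x) := by
  have h := Real.one_sub_inv_le_log_of_pos (show 0 < 1 + x by linarith)
  refine le_trans ?_ h
  have h0 : 0 < 1 + x := by linarith
  have : 1 - (1 + x)⁻¹ = x - x ^ 2 / (1 + x) := by field_simp; ring
  rw [this]
  have : x ^ 2 / (1 + x) ≤ 2 * x ^ 2 := by
    rw [div_le_iff₀ h0]; nlinarith [sq_nonneg x]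
  linarith

lemma log_main (t d dv m : ℝ) (ht : 0 ≤ t) (hd : 16 * (t + 1) ≤ d) (hdv : d / 4 ≤ dv)
    (hm0 : 0 ≤ m) (hm : m ≤ t) :
    (1 + m / (d - m)) * (1 - d / dv) + (1 - d / dv) ^ 2 / 20 ≤
      Real.log ((dv - m) / (d - m)) := by
  have d0 : 0 < d := by linarith
  have dv0 : 0 < dv := by linarith
  have dm : 0 < d - m := by linarith
  have dvm : 0 < dv - m := by linarith
  set y := 1 - d / dv with hy
  set κ := m / (d - m) with hκ
  have k0 : 0 ≤ κ := by positivity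
  have k1 : κ ≤ 1 / 15 := by rw [hκ, div_le_div_iff₀ dm (by norm_num)]; linarith
  have hz : d / dv ≤ 4 := by rw [div_le_iff₀ dv0]; linarith
  have hz0 : 0 < d / dv := by positivity
  have hy1 : y < 1 := by linarith
  have hy3 : -3 ≤ y := by linarith
  have e1 : (dv - m) / (d - m) = (1 + κ * y) / (1 - y) := by
    have q1 : 1 - y = d / dv := by rw [hy]; ring
    have q2 : 1 + κ * y = d * (dv - m) / ((d - m) * dv) := by
      rw [hκ, hy]; field_simp; ring
    rw [q1, q2]
    field_simp
  have hpos : 0 < 1 + κ * y := by nlinarith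
  rw [e1, Real.log_div hpos.ne' (by linarith)]
  have l1 := log_ub (1 - y) (by linarith) (by linarith)
  have l2 := log_lb (κ * y) (by nlinarith)
  have l3 : (κ * y) ^ 2 ≤ (1 / 225) * y ^ 2 := by
    rw [mul_pow]
    apply mul_le_mul_of_nonneg_right _ (sq_nonneg _)
    nlinarith
  nlinarith [sq_nonneg y]

lemma good_le {k j : ℕ} (hjk : j ≤ k) {f : ℕ → β} (hf : Good G p k f) : Good G p j f :=
  ⟨fun i hi l hl h => hf.1 i (by omega) l (by omega) h, fun i hi => hf.2 i (by omega)⟩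

lemma Hyp.log_step (H : Hyp t d G p) {k : ℕ} (hk1 : 1 ≤ k) (hk : k ≤ t) {f : ℕ → β}
    (hf : Good G p k f) :
    df G p k f / dg G (f (p (k + 1))) + (1 + k / (d - k)) * yy d G (f (p (k + 1)))
      + (1 / 20) * yy d G (f (p (k + 1))) ^ 2 ≤ Real.log (av G p (k + 1) f / (d - k)) := by
  set v := f (p (k + 1)) with hv
  have hkt : (k:ℝ) ≤ t := by exact_mod_cast hk
  have hk1' : (1:ℝ) ≤ k := by exact_mod_cast hk1
  have hd := H.hd
  have hdg := H.dgpos v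
  have h1 := log_main t d (dg G v) k (by positivity) H.hd (H.hmin v) (by positivity) hkt
  have hav := av_eq hf
  rw [← hv] at hav
  have p1 : 0 < dg G v - k := by linarith
  have p2 : 0 < d - k := by linarith
  have hav0 := H.av_pos hk hf
  rw [Real.log_div p1.ne' p2.ne'] at h1
  rw [Real.log_div hav0.ne' p2.ne']
  have h2 : df G p k f / dg G v ≤ Real.log (av G p (k + 1) f) - Real.log (dg G v - k) := by
    have hc := us_card (G := G) H.hp k f
    unfold df
    split_ifs with hlt
    · have hge : dg G v - k + 1 ≤ av G p (k + 1) f := by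
        have : ((us G p k f).card : ℝ) + 1 ≤ k := by exact_mod_cast hlt
        linarith
      rw [← Real.log_div hav0.ne' p1.ne']
      have h3 := Real.one_sub_inv_le_log_of_pos (div_pos hav0 p1)
      refine le_trans ?_ h3
      rw [inv_div, div_le_iff₀ (by linarith)]
      have h4 : (dg G v - k) / av G p (k + 1) f ≤ (dg G v - k) / (dg G v - k + 1) :=
        div_le_div_of_nonneg_left p1.le (by linarith) hge
      have h5 : (dg G v - k) / (dg G v - k + 1) ≤ 1 - 1 / dg G v := by
        have : 1 / dg G v ≤ 1 / (dg G v - k + 1) := one_div_le_one_div_of_le (by linarith) (by linarith)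
        have : (dg G v - k) / (dg G v - k + 1) = 1 - 1 / (dg G v - k + 1) := by
          field_simp; ring
        linarith
      have h6 : 1 / dg G v ≤ 1 - (dg G v - k) / av G p (k + 1) f := by linarith
      rw [div_le_iff₀ (by linarith)] at h6
      exact h6
    · rw [zero_div, sub_nonneg]
      apply Real.log_le_log p1
      have : ((us G p k f).card : ℝ) ≤ k := by exact_mod_cast hc
      linarith
  have : yy d G v = 1 - d / dg G v := rfl
  rw [this]
  linarith

noncomputable def D0 (t : ℕ) : ℝ :=
  16 * ((t : ℝ) + 1) + 80 * t * Kc t t * (4 * t * Kc t t + 1)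

lemma df_congr (hp : ∀ k, p (k + 1) ≤ k) {k : ℕ} {f f' : ℕ → β} (h : ∀ l ≤ k, f l = f' l) :
    df G p k f = df G p k f' := by
  have : us G p k f = us G p k f' := by
    unfold us
    apply filter_congr
    intro l hl
    rw [mem_range] at hl
    rw [h _ (hp k), h l (by omega)]
  unfold df; rw [this]

lemma Hyp.pi_yy (H : Hyp t d G p) : Piw G (yy d G) = 0 := by
  unfold Piw yy
  have : ∀ v, dg G v * (1 - d / dg G v) = dg G v - d := by
    intro v
    have := (H.dgpos' v).ne'
    field_simp
  simp only [this, sum_sub_distrib, sum_const, H.hM]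
  simp

lemma Hyp.EX (H : Hyp t d G p) (hD : D0 t ≤ d) (ht : 3 ≤ t) (hp2 : p 2 = 0) :
    (1 / 2) * (∑ k ∈ range t, Gm G p k) + (1 / 40) * Rr d G ≤
      Ex G p t (fun f => ∑ k ∈ Ico 1 t, Real.log (av G p (k + 1) f / (d - k))) := by
  set K := Kc t t with hK
  have hK0 : 0 ≤ K := Kc_nonneg t t
  have ht0 : (0:ℝ) ≤ t := by positivity
  set q := 4 * t * K + 1 with hq
  have hq1 : 1 ≤ q := by rw [hq]; nlinarith [mul_nonneg ht0 hK0]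
  set η := 1 / q with hη
  have hη0 : 0 < η := by positivity
  have hη1 : η ≤ 1 := by rw [hη, div_le_one (by linarith)]; exact hq1
  have hd := H.dpos
  have hR := H.Rr_nonneg
  set Γ := ∑ k ∈ range t, Gm G p k with hΓ
  have hG : ∀ k, 0 ≤ Gm G p k := H.Gm_nonneg
  have hΓ0 : 0 ≤ Γ := sum_nonneg fun k _ => hG k
  set ε := η * Γ + (1 / (η * d)) * Rr d G with hε
  have hε0 : 0 ≤ ε := by positivity
  have hy : ∀ j ≤ t, |Ex G p t (fun f => yy d G (f j))| ≤ K * ε := by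
    intro j hj
    rw [H.ex_coord hj le_rfl]
    exact (H.main_err hη0 hη1 j hj _ H.pi_yy le_rfl).trans
      (mul_le_mul_of_nonneg_right (Kc_mono t hj) hε0)
  have s1 : Ex G p t (fun f => ∑ k ∈ Ico 1 t, (df G p k f / dg G (f (p (k + 1)))
      + (1 + k / (d - k)) * yy d G (f (p (k + 1)))
      + (1 / 20) * yy d G (f (p (k + 1))) ^ 2)) ≤
      Ex G p t (fun f => ∑ k ∈ Ico 1 t, Real.log (av G p (k + 1) f / (d - k))) := by
    apply H.ex_mono
    intro f hf
    apply sum_le_sum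
    intro k hk
    rw [mem_Ico] at hk
    exact H.log_step hk.1 (by omega) (good_le (by omega) hf)
  refine le_trans ?_ s1
  have s2 : Ex G p t (fun f => ∑ k ∈ Ico 1 t, (df G p k f / dg G (f (p (k + 1)))
      + (1 + k / (d - k)) * yy d G (f (p (k + 1)))
      + (1 / 20) * yy d G (f (p (k + 1))) ^ 2)) =
      ∑ k ∈ Ico 1 t, (Ex G p t (fun f => df G p k f / dg G (f (p (k + 1))))
      + (1 + k / (d - k)) * Ex G p t (fun f => yy d G (f (p (k + 1))))
      + (1 / 20) * Ex G p t (fun f => yy d G (f (p (k + 1))) ^ 2)) := by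
    unfold Ex
    rw [op_sum]
    apply sum_congr rfl
    intro k _
    rw [op_add, op_add, op_smul, op_smul]
  rw [s2, sum_add_distrib, sum_add_distrib]
  have s3 : ∑ k ∈ Ico 1 t, Ex G p t (fun f => df G p k f / dg G (f (p (k + 1)))) = Γ := by
    have : Γ = ∑ k ∈ Ico 1 t, Gm G p k := by
      rw [hΓ, range_eq_Ico, sum_eq_sum_Ico_succ_bot (by omega)]
      have : Gm G p 0 = 0 := by
        unfold Gm df
        simp only [not_lt_zero, if_false, zero_div]
        exact op_zero 0
      rw [this, zero_add]
    rw [this]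
    apply sum_congr rfl
    intro k hk
    rw [mem_Ico] at hk
    apply H.ex_down (by omega) le_rfl
    intro f i u hi
    have hpk := H.hp k
    rw [Function.update_of_ne (by omega), df_congr H.hp (f' := f)]
    intro l hl
    rw [Function.update_of_ne (by omega)]
  have s4 : -(2 * t * (K * ε)) ≤
      ∑ k ∈ Ico 1 t, (1 + k / (d - k)) * Ex G p t (fun f => yy d G (f (p (k + 1)))) := by
    have : ∀ k ∈ Ico 1 t, -(2 * (K * ε)) ≤
        (1 + k / (d - k)) * Ex G p t (fun f => yy d G (f (p (k + 1)))) := by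
      intro k hk
      rw [mem_Ico] at hk
      have c0 := hy (p (k + 1)) (by have := H.hp k; omega)
      rw [abs_le] at c0
      have c1 : (k:ℝ) ≤ t := by exact_mod_cast hk.2.le
      have c2 := H.hd
      have c3 : (0:ℝ) ≤ k := by positivity
      have c4 : (k:ℝ) / (d - k) ≤ 1 := by rw [div_le_one (by linarith)]; linarith
      have c5 : 0 ≤ (k:ℝ) / (d - k) := div_nonneg c3 (by linarith)
      have c6 : 0 ≤ K * ε := by positivity
      nlinarith
    refine le_trans ?_ (sum_le_sum this)
    rw [sum_const, nsmul_eq_mul, Nat.card_Ico]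
    have c6 : 0 ≤ K * ε := by positivity
    have : ((t - 1 : ℕ) : ℝ) ≤ t := by exact_mod_cast Nat.sub_le _ _
    nlinarith
  have s5 : (1 / 20) * Rr d G ≤
      ∑ k ∈ Ico 1 t, (1 / 20) * Ex G p t (fun f => yy d G (f (p (k + 1))) ^ 2) := by
    have hnn : ∀ k, 0 ≤ Ex G p t (fun f => yy d G (f (p (k + 1))) ^ 2) := by
      intro k
      have := H.ex_mono t (fun _ => 0) (fun f => yy d G (f (p (k + 1))) ^ 2)
        (fun f _ => sq_nonneg _)
      rwa [show Ex G p t (fun _ => 0) = 0 from op_zero t] at this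
    have h1 := single_le_sum (f := fun k => (1 / 20) * Ex G p t (fun f => yy d G (f (p (k + 1))) ^ 2))
      (s := Ico 1 t) (fun k _ => by have := hnn k; positivity) (mem_Ico.2 ⟨le_rfl, by omega⟩)
    refine le_trans (le_of_eq ?_) h1
    simp only [show 1 + 1 = 2 from rfl, hp2]
    rw [H.ex_coord (Nat.zero_le _) le_rfl (fun v => yy d G v ^ 2),
      ex_zero_eq (fun v => yy d G v ^ 2)]
    rfl
  rw [s3]
  have f1 : 2 * t * K * η ≤ 1 / 2 := by
    rw [hη, mul_one_div, div_le_div_iff₀ (by linarith) (by norm_num), hq]; linarith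
  have f2 : 2 * t * K * (1 / (η * d)) ≤ 1 / 40 := by
    have : 1 / (η * d) = q / d := by rw [hη]; field_simp
    rw [this, mul_div_assoc', div_le_div_iff₀ (by linarith) (by norm_num)]
    unfold D0 at hD
    rw [← hK, ← hq] at hD
    nlinarith
  have f3 := mul_le_mul_of_nonneg_right f1 hΓ0
  have f4 := mul_le_mul_of_nonneg_right f2 hR
  rw [hε] at s4
  nlinarith

lemma Hyp.core (H : Hyp t d G p) (hD : D0 t ≤ d) (ht : 3 ≤ t) (hp2 : p 2 = 0) :
    (Fintype.card β : ℝ) * (∏ i ∈ range t, (d - i)) *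
      (1 + ((1 / 2) * (∑ k ∈ range t, Gm G p k) + (1 / 40) * Rr d G)) ≤ Nx G p t (fun _ => 1) := by
  have hpos : ∀ k ∈ Ico 1 t, 0 < d - k := by
    intro k hk
    rw [mem_Ico] at hk
    have c1 : (k:ℝ) ≤ t := by exact_mod_cast hk.2.le
    have := H.hd
    linarith [(by positivity : (0:ℝ) ≤ t)]
  have hPpos : 0 < ∏ k ∈ Ico 1 t, (d - (k:ℝ)) := prod_pos hpos
  have hp1 : p 1 = 0 := Nat.le_zero.1 (H.hp 0)
  have e1 : ∏ i ∈ range t, (d - (i:ℝ)) = d * ∏ k ∈ Ico 1 t, (d - (k:ℝ)) := by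
    rw [range_eq_Ico, prod_eq_prod_Ico_succ_bot (by omega)]; simp
  have hEX := H.EX hD ht hp2
  set X : (ℕ → β) → ℝ := fun f => ∑ k ∈ Ico 1 t, Real.log (av G p (k + 1) f / (d - k)) with hX
  have e2 : Ex G p t (fun f => (∏ k ∈ Ico 1 t, (d - (k:ℝ))) * (1 + X f)) ≤
      Ex G p t (fun f => 1 * ((∏ i ∈ range t, av G p (i + 1) f) / dg G (f 0))) := by
    apply H.ex_mono
    intro f hf
    have a1 : av G p 1 f = dg G (f 0) := by
      have := av_eq (good_le (Nat.zero_le t) hf)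
      have h2 := us_card (G := G) H.hp 0 f
      have h3 : (us G p 0 f).card = 0 := by omega
      rw [h3] at this
      simpa [hp1] using this
    rw [range_eq_Ico, prod_eq_prod_Ico_succ_bot (show 0 < t by omega), zero_add, a1]
    have a2 := (H.dgpos' (f 0)).ne'
    have a3 : 1 * (dg G (f 0) * (∏ k ∈ Ico 1 t, av G p (k + 1) f) / dg G (f 0)) =
        ∏ k ∈ Ico 1 t, av G p (k + 1) f := by field_simp
    rw [a3]
    have a4 : ∀ k ∈ Ico 1 t, 0 < av G p (k + 1) f := by
      intro k hk
      rw [mem_Ico] at hk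
      exact H.av_pos (by omega) (good_le (by omega) hf)
    have a5 : Real.exp (X f) = ∏ k ∈ Ico 1 t, (av G p (k + 1) f / (d - k)) := by
      rw [hX]
      simp only
      rw [Real.exp_sum]
      apply prod_congr rfl
      intro k hk
      rw [Real.exp_log (div_pos (a4 k hk) (hpos k hk))]
    rw [prod_div_distrib] at a5
    have a6 := Real.add_one_le_exp (X f)
    rw [a5, le_div_iff₀ hPpos] at a6
    linarith
  have e3 := H.ex_nx le_rfl (fun _ => 1)
  rw [← e3, e1, H.hM]
  have e4 : Ex G p t (fun f => (∏ k ∈ Ico 1 t, (d - (k:ℝ))) * (1 + X f)) =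
      (∏ k ∈ Ico 1 t, (d - (k:ℝ))) * (1 + Ex G p t X) := by
    have := H.ex_one (le_refl t)
    unfold Ex at this ⊢
    rw [op_smul, op_add, this]
  rw [e4] at e2
  have hd := H.dpos
  have hM : 0 ≤ (Fintype.card β : ℝ) * d := by positivity
  have e5 : (∏ k ∈ Ico 1 t, (d - (k:ℝ))) * (1 + ((1 / 2) * (∑ k ∈ range t, Gm G p k) +
      (1 / 40) * Rr d G)) ≤ (∏ k ∈ Ico 1 t, (d - (k:ℝ))) * (1 + Ex G p t X) :=
    mul_le_mul_of_nonneg_left (by linarith) hPpos.le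
  have e6 := mul_le_mul_of_nonneg_left (e5.trans e2) hM
  linarith

/-- states -/
noncomputable def St (G : SimpleGraph β) (p : ℕ → ℕ) : ℕ → Finset (ℕ → β)
  | 0 => univ.image (fun u _ => u)
  | k + 1 => (St G p k).biUnion (fun f => (avail G p (k + 1) f).image (Function.update f (k + 1)))

lemma mem_St (hp : ∀ k, p (k + 1) ≤ k) (k : ℕ) : ∀ f : ℕ → β,
    f ∈ St G p k ↔ Good G p k f ∧ ∀ l > k, f l = f 0 := by
  induction k with
  | zero =>
    intro f
    simp only [St, mem_image, mem_univ, true_and]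
    constructor
    · rintro ⟨u, rfl⟩; exact ⟨good_zero _, fun _ _ => rfl⟩
    · rintro ⟨_, h⟩
      refine ⟨f 0, ?_⟩
      funext l
      rcases Nat.eq_zero_or_pos l with rfl | hl
      · rfl
      · exact (h l hl).symm
  | succ k ih =>
    intro f
    simp only [St, mem_biUnion, mem_image]
    constructor
    · rintro ⟨g, hg, u, hu, rfl⟩
      rw [ih] at hg
      refine ⟨good_succ hp hg.1 hu, ?_⟩
      intro l hl
      rw [Function.update_of_ne (by omega), Function.update_of_ne (by omega)]
      exact hg.2 l (by omega)
    · rintro ⟨hf, hl⟩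
      refine ⟨Function.update f (k + 1) (f 0), ?_, f (k + 1), ?_, ?_⟩
      · rw [ih]
        constructor
        · constructor
          · intro i hi j hj hij
            rw [Function.update_of_ne (by omega), Function.update_of_ne (by omega)] at hij
            exact hf.1 i (by omega) j (by omega) hij
          · intro i hi
            have := hp i
            rw [Function.update_of_ne (by omega), Function.update_of_ne (by omega)]
            exact hf.2 i (by omega)
        · intro l hlk
          rw [Function.update_of_ne (by omega : 0 ≠ k + 1)]
          by_cases h : l = k + 1
          · subst h; rw [Function.update_self]
          · rw [Function.update_of_ne h]; exact hl l (by omega)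
      · have := hp k
        simp only [avail, nb, mem_filter, mem_univ, true_and]
        constructor
        · rw [Function.update_of_ne (by omega)]
          exact hf.2 k (by omega)
        · intro l hl h
          rw [Function.update_of_ne (by omega)] at h
          have := hf.1 l (by omega) (k + 1) le_rfl h
          omega
      · simp

lemma Nx_eq (hp : ∀ k, p (k + 1) ≤ k) (k : ℕ) : ∀ F : (ℕ → β) → ℝ,
    Nx G p k F = ∑ f ∈ St G p k, F f := by
  induction k with
  | zero =>
    intro F
    simp only [Nx, Op, St, one_mul]
    rw [sum_image]
    intro u _ v _ h
    exact congrFun h 0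
  | succ k ih =>
    intro F
    have hR : Nx G p (k + 1) F = Nx G p k (fun f => 1 * ∑ u ∈ avail G p (k + 1) f,
      F (Function.update f (k + 1) u)) := rfl
    rw [hR, ih]
    simp only [St]
    rw [sum_biUnion]
    · apply sum_congr rfl
      intro f _
      rw [sum_image, one_mul]
      intro u _ v _ h
      exact Function.update_injective f (k + 1) h
    · intro f hf g hg hfg
      rw [Function.onFun, disjoint_left]
      intro x hx hx'
      rw [mem_image] at hx hx'
      obtain ⟨u, _, rfl⟩ := hx
      obtain ⟨v, _, h⟩ := hx'
      apply hfg
      rw [mem_coe, mem_St hp] at hf hg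
      have key : ∀ l ≠ k + 1, f l = g l := by
        intro l hl
        have := congrFun h l
        rw [Function.update_of_ne hl, Function.update_of_ne hl] at this
        exact this.symm
      funext l
      by_cases hl : l = k + 1
      · subst hl
        rw [hf.2 _ (by omega), hg.2 _ (by omega)]
        exact key 0 (by omega)
      · exact key l hl

lemma Hyp.ex_eq_zero (H : Hyp t d G p) {k : ℕ} (hk : k ≤ t) : ∀ F : (ℕ → β) → ℝ,
    (∀ f, Good G p k f → 0 ≤ F f) → Ex G p k F = 0 → ∀ f ∈ St G p k, F f = 0 := by
  induction k with
  | zero =>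
    intro F hF h f hf
    simp only [St, mem_image, mem_univ, true_and] at hf
    obtain ⟨u, rfl⟩ := hf
    simp only [Ex, Op] at h
    have h0 : ∀ v ∈ univ, 0 ≤ dg G v / (∑ v, dg G v) * F (fun _ => v) := fun v _ =>
      mul_nonneg (div_nonneg (dg_nonneg v) H.Mpos.le) (hF _ (good_zero _))
    rw [sum_eq_zero_iff_of_nonneg h0] at h
    have := h u (mem_univ _)
    have h1 := H.dgpos' u
    have h2 := H.Mpos
    rcases mul_eq_zero.1 this with h3 | h3
    · exact absurd h3 (by positivity)
    · exact h3
  | succ k ih =>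
    intro F hF h f hf
    simp only [St, mem_biUnion, mem_image] at hf
    obtain ⟨g, hg, u, hu, rfl⟩ := hf
    have hgood := ((mem_St H.hp k g).1 hg).1
    have hnn : ∀ f, Good G p k f → ∀ u ∈ avail G p (k + 1) f, 0 ≤ F (Function.update f (k + 1) u) :=
      fun f hf u hu => hF _ (good_succ H.hp hf hu)
    have h1 := ih (by omega) (fun f => (av G p (k + 1) f)⁻¹ * ∑ u ∈ avail G p (k + 1) f,
      F (Function.update f (k + 1) u)) (fun f hf => mul_nonneg
        (inv_nonneg.2 (H.av_pos (by omega) hf).le) (sum_nonneg (hnn f hf))) h g hg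
    have h2 := H.av_pos (by omega : k ≤ t) hgood
    rcases mul_eq_zero.1 h1 with h3 | h3
    · exact absurd h3 (by positivity)
    · rw [sum_eq_zero_iff_of_nonneg (hnn g hgood)] at h3
      exact h3 u hu

/-- The main dichotomy for graphs of large minimum degree. -/
lemma Hyp.final (H : Hyp t d G p) (hD : D0 t ≤ d) (ht : 3 ≤ t) (hp2 : p 2 = 0) (hp3 : p 3 = 1) :
    (Fintype.card β : ℝ) * (∏ i ∈ range t, (d - i)) < Nx G p t (fun _ => 1) ∨
    ((Fintype.card β : ℝ) * (∏ i ∈ range t, (d - i)) ≤ Nx G p t (fun _ => 1) ∧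
    (∀ v, dg G v = d) ∧ ∀ u v w, G.Adj u v → G.Adj u w → v ≠ w → G.Adj v w) := by
  have hcore := H.core hD ht hp2
  have hG : ∀ k, 0 ≤ Gm G p k := H.Gm_nonneg
  have hR := H.Rr_nonneg
  have hΓ : 0 ≤ ∑ k ∈ range t, Gm G p k := sum_nonneg fun k _ => hG k
  have hp1 : p 1 = 0 := Nat.le_zero.1 (H.hp 0)
  have hP : 0 < (Fintype.card β : ℝ) * (∏ i ∈ range t, (d - i)) := by
    apply mul_pos
    · exact_mod_cast H.hn
    · apply prod_pos
      intro k hk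
      rw [mem_range] at hk
      have c1 : (k:ℝ) ≤ t := by exact_mod_cast hk.le
      have := H.hd
      linarith [(by positivity : (0:ℝ) ≤ t)]
  by_cases hz : 0 < (1 / 2) * (∑ k ∈ range t, Gm G p k) + (1 / 40) * Rr d G
  · left; nlinarith
  · right
    have hR0 : Rr d G = 0 := by linarith
    have hΓ0 : ∑ k ∈ range t, Gm G p k = 0 := by linarith
    refine ⟨?_, ?_, ?_⟩
    · rw [hR0, hΓ0] at hcore; linarith
    · intro v
      unfold Rr Piw at hR0
      rw [div_eq_zero_iff] at hR0
      have h1 := hR0.resolve_right H.Mpos.ne'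
      rw [sum_eq_zero_iff_of_nonneg (fun v _ => mul_nonneg (dg_nonneg v) (sq_nonneg _))] at h1
      have h2 := h1 v (mem_univ _)
      have h3 := H.dgpos' v
      have h4 := (mul_eq_zero.1 h2).resolve_left h3.ne'
      have h5 : yy d G v = 0 := by simpa using h4
      unfold yy at h5
      field_simp at h5
      linarith
    · intro u v w huv huw hvw
      rw [sum_eq_zero_iff_of_nonneg (fun k _ => hG k)] at hΓ0
      have h2 := hΓ0 2 (mem_range.2 (by omega))
      unfold Gm at h2
      have hnn : ∀ f, 0 ≤ df G p 2 f := by intro f; unfold df; split_ifs <;> norm_num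
      set f : ℕ → β := fun l => if l = 1 then v else if l = 2 then w else u with hf
      have f0 : f 0 = u := by simp [hf]
      have f1 : f 1 = v := by simp [hf]
      have f2 : f 2 = w := by simp [hf]
      have h3 := H.ex_eq_zero (by omega) _ (fun f _ => div_nonneg (hnn f) (dg_nonneg _)) h2 f (by
        rw [mem_St H.hp]
        have n1 := huv.ne
        have n2 := huw.ne
        refine ⟨⟨?_, ?_⟩, ?_⟩
        · intro i hi j hj hij
          interval_cases i <;> interval_cases j <;> simp_all
        · intro i hi
          interval_cases i
          · simp only [zero_add, hp1, f0, f1]; exact huv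
          · simp only [show 1 + 1 = 2 from rfl, hp2, f0, f2]; exact huw
        · intro l hl
          simp [hf, show l ≠ 1 by omega, show l ≠ 2 by omega])
      have h4 := (div_eq_zero_iff.1 h3).resolve_right (H.dgpos' _).ne'
      unfold df at h4
      have h5 : ¬ (us G p 2 f).card < 2 := by
        intro h; rw [if_pos h] at h4; norm_num at h4
      by_contra hnot
      apply h5
      have : us G p 2 f ⊆ {0} := by
        intro l hl
        simp only [us, mem_filter, mem_range, show 2 + 1 = 3 from rfl, hp3, f1] at hl
        obtain ⟨hl1, hl2⟩ := hl
        interval_cases l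
        · simp
        · rw [f1] at hl2; exact absurd hl2 (G.irrefl)
        · rw [f2] at hl2; exact absurd hl2 hnot
      have := card_le_card this
      simp at this
      omega

end TreeCount

namespace TreeCount
open Finset
open scoped Classical

variable {β : Type} [Fintype β]
variable {G : SimpleGraph β} {p : ℕ → ℕ}
variable {t : ℕ} {d : ℝ}

structure Ord {α : Type} (T : SimpleGraph α) (p : ℕ → ℕ) (e : ℕ → α) (k : ℕ) : Prop where
  hp : ∀ i, p (i + 1) ≤ i
  hp2 : p 2 = 0
  hp3 : p 3 = 1
  inj : ∀ i ≤ k, ∀ j ≤ k, e i = e j → i = j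
  adj : ∀ i < k, T.Adj (e (p (i + 1))) (e (i + 1))

lemma ord_base {α : Type} (T : SimpleGraph α) (hT : T.IsTree) (u v : α) (h : 3 ≤ T.dist u v) :
    ∃ p e, Ord T p e 3 := by
  obtain ⟨w, hw⟩ := (hT.connected u v).exists_walk_length_eq_dist
  have hpath := w.isPath_of_length_eq_dist hw
  have hinj := hpath.getVert_injOn
  have hne : ∀ i j, i ≤ 3 → j ≤ 3 → w.getVert i = w.getVert j → i = j := by
    intro i j hi hj hij
    exact hinj (by rw [Set.mem_ofPred_eq]; omega) (by rw [Set.mem_ofPred_eq]; omega) hij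
  refine ⟨fun i => if i = 3 then 1 else 0, fun i => w.getVert (if i = 0 then 1 else if i = 1 then 2
    else if i = 2 then 0 else 3), ?_, rfl, rfl, ?_, ?_⟩
  · intro i
    split_ifs <;> omega
  · intro i hi j hj hij
    have := hne _ _ (by split_ifs <;> omega) (by split_ifs <;> omega) hij
    split_ifs at this <;> omega
  · intro i hi
    have a0 := w.adj_getVert_succ (i := 0) (by omega)
    have a1 := w.adj_getVert_succ (i := 1) (by omega)
    have a2 := w.adj_getVert_succ (i := 2) (by omega)
    interval_cases i
    · simpa using a1
    · simpa using a0.symm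
    · simpa using a2

lemma ord_step {α : Type} [Fintype α] (T : SimpleGraph α) (hT : T.IsTree) {p : ℕ → ℕ} {e : ℕ → α}
    {k : ℕ} (hk : 3 ≤ k) (h : Ord T p e k) (hc : k + 1 < Fintype.card α) :
    ∃ p e, Ord T p e (k + 1) := by
  set S : Finset α := (range (k + 1)).image e with hS
  have hSc : S.card ≤ k + 1 := card_image_le.trans (by simp)
  obtain ⟨a, ha⟩ : ∃ a, a ∉ S := by
    by_contra hcon
    push Not at hcon
    have : S = univ := by ext x; simp [hcon x]
    rw [this, card_univ] at hSc
    omega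
  obtain ⟨w⟩ := hT.connected (e 0) a
  obtain ⟨dt, _, h1, h2⟩ := w.exists_boundary_dart (S : Set α) (by
    rw [mem_coe, hS, mem_image]; exact ⟨0, by simp, rfl⟩) (by simpa using ha)
  rw [mem_coe] at h1 h2
  rw [hS, mem_image] at h1
  obtain ⟨j, hj, hje⟩ := h1
  rw [mem_range] at hj
  have hnot : ∀ i ≤ k, e i ≠ dt.snd := by
    intro i hi hei
    exact h2 (by rw [hS, mem_image]; exact ⟨i, mem_range.2 (by omega), hei⟩)
  refine ⟨Function.update p (k + 1) j, Function.update e (k + 1) dt.snd, ?_, ?_, ?_, ?_, ?_⟩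
  · intro i
    by_cases hi : i = k
    · subst hi; rw [Function.update_self]; omega
    · rw [Function.update_of_ne (by omega)]; exact h.hp i
  · rw [Function.update_of_ne (by omega)]; exact h.hp2
  · rw [Function.update_of_ne (by omega)]; exact h.hp3
  · intro i hi l hl hil
    rcases Nat.lt_or_ge i (k+1) with hi' | hi' <;> rcases Nat.lt_or_ge l (k+1) with hj' | hj'
    · rw [Function.update_of_ne (by omega), Function.update_of_ne (by omega)] at hil
      exact h.inj i (by omega) l (by omega) hil
    · have : l = k + 1 := by omega
      subst this
      rw [Function.update_of_ne (by omega), Function.update_self] at hil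
      exact absurd hil (hnot i (by omega))
    · have : i = k + 1 := by omega
      subst this
      rw [Function.update_self, Function.update_of_ne (by omega)] at hil
      exact absurd hil.symm (hnot l (by omega))
    · omega
  · intro i hi
    by_cases hik : i = k
    · subst hik
      rw [Function.update_self, Function.update_self, Function.update_of_ne (by omega), hje]
      exact dt.adj
    · have := h.hp i
      rw [Function.update_of_ne (by omega : i + 1 ≠ k + 1), Function.update_of_ne (by omega),
        Function.update_of_ne (by omega)]
      exact h.adj i (by omega)

lemma ord_exists {α : Type} [Fintype α] (T : SimpleGraph α) (hT : T.IsTree) {t : ℕ}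
    (hc : Fintype.card α = t + 1) (h : ∃ u v : α, 3 ≤ T.dist u v) :
    3 ≤ t ∧ ∃ p e, Ord T p e t := by
  obtain ⟨u, v, h⟩ := h
  have ht : 3 ≤ t := by
    obtain ⟨p, e, ho⟩ := ord_base T hT u v h
    have : ((range 4).image e).card = 4 := by
      rw [card_image_of_injOn]
      · simp
      · intro i hi j hj hij
        simp only [coe_range, Set.mem_Iio] at hi hj
        exact ho.inj i (by omega) j (by omega) hij
    have h2 := card_le_univ ((range 4).image e)
    omega
  refine ⟨ht, ?_⟩
  have : ∀ k, 3 ≤ k → k ≤ t → ∃ p e, Ord T p e k := by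
    intro k hk
    induction k, hk using Nat.le_induction with
    | base => intro _; exact ord_base T hT u v h
    | succ k hk ih =>
      intro hkt
      obtain ⟨p, e, ho⟩ := ih (by omega)
      exact ord_step T hT hk ho (by omega)
  exact this t ht le_rfl

lemma ord_surj {α : Type} [Fintype α] {T : SimpleGraph α} {p : ℕ → ℕ} {e : ℕ → α} {t : ℕ}
    (h : Ord T p e t) (hc : Fintype.card α = t + 1) (a : α) : ∃ i ≤ t, e i = a := by
  have h1 : ((range (t + 1)).image e).card = t + 1 := by
    rw [card_image_of_injOn]
    · simp
    · intro i hi j hj hij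
      simp only [coe_range, Set.mem_Iio] at hi hj
      exact h.inj i (by omega) j (by omega) hij
  have h2 : (range (t + 1)).image e = univ := by
    rw [← card_eq_iff_eq_univ, h1, hc]
  have := mem_univ a
  rw [← h2, mem_image] at this
  obtain ⟨i, hi, rfl⟩ := this
  exact ⟨i, by rw [mem_range] at hi; omega, rfl⟩

lemma ord_edges {α : Type} [Fintype α] {T : SimpleGraph α} (hT : T.IsTree) {p : ℕ → ℕ} {e : ℕ → α}
    {t : ℕ} (h : Ord T p e t) (hc : Fintype.card α = t + 1) {a b : α} (hab : T.Adj a b) :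
    ∃ i < t, s(a, b) = s(e (p (i + 1)), e (i + 1)) := by
  set I := (range t).image (fun i => s(e (p (i + 1)), e (i + 1))) with hI
  have h1 : I.card = t := by
    rw [hI, card_image_of_injOn, card_range]
    have key : ∀ i j, i < j → j < t → s(e (p (i + 1)), e (i + 1)) ≠ s(e (p (j + 1)), e (j + 1)) := by
      intro i j hij hj heq
      have hpi := h.hp i
      have hm : e (j + 1) ∈ s(e (p (i + 1)), e (i + 1)) := by rw [heq]; simp
      rw [Sym2.mem_iff] at hm
      rcases hm with hm | hm
      · have := h.inj _ (by omega) _ (by omega) hm; omega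
      · have := h.inj _ (by omega) _ (by omega) hm; omega
    intro i hi j hj hij
    simp only [coe_range, Set.mem_Iio] at hi hj
    rcases lt_trichotomy i j with hlt | rfl | hlt
    · exact absurd hij (key i j hlt hj)
    · rfl
    · exact absurd hij.symm (key j i hlt hi)
  have h2 : I ⊆ T.edgeFinset := by
    intro x hx
    rw [hI, mem_image] at hx
    obtain ⟨i, hi, rfl⟩ := hx
    rw [SimpleGraph.mem_edgeFinset, SimpleGraph.mem_edgeSet]
    exact h.adj i (mem_range.1 hi)
  have h3 := hT.card_edgeFinset
  have h4 : I = T.edgeFinset := eq_of_subset_of_card_le h2 (by omega)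
  have : s(a, b) ∈ T.edgeFinset := by
    rw [SimpleGraph.mem_edgeFinset, SimpleGraph.mem_edgeSet]; exact hab
  rw [← h4, hI, mem_image] at this
  obtain ⟨i, hi, hi2⟩ := this
  exact ⟨i, mem_range.1 hi, hi2.symm⟩

lemma monCount_eq {α : Type} [Fintype α] {T : SimpleGraph α} (hT : T.IsTree) {p : ℕ → ℕ} {e : ℕ → α}
    {t : ℕ} (h : Ord T p e t) (hc : Fintype.card α = t + 1) (G : SimpleGraph β) :
    (monCount T G : ℝ) = Nx G p t (fun _ => 1) := by
  rw [Nx_eq h.hp, sum_const, nsmul_eq_mul, mul_one]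
  congr 1
  unfold monCount
  rw [Nat.card_eq_fintype_card, Fintype.card_subtype]
  choose idx hidx1 hidx2 using ord_surj h hc
  have hidx3 : ∀ i ≤ t, idx (e i) = i := fun i hi =>
    h.inj _ (hidx1 _) _ hi (hidx2 _)
  refine card_nbij' (fun f l => if l ≤ t then f (e l) else f (e 0)) (fun g a => g (idx a)) ?_ ?_ ?_ ?_
  · intro f hf
    simp only [coe_filter, mem_univ, true_and, Set.mem_ofPred_eq] at hf
    rw [mem_coe, mem_St h.hp]
    refine ⟨⟨?_, ?_⟩, ?_⟩
    · intro i hi j hj hij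
      simp only [if_pos hi, if_pos hj] at hij
      exact h.inj i hi j hj (hf.1 hij)
    · intro i hi
      have := h.hp i
      dsimp only
      rw [if_pos (by omega), if_pos (by omega)]
      exact hf.2 (h.adj i hi)
    · intro l hl
      dsimp only
      rw [if_neg (by omega), if_pos (by omega)]
  · intro g hg
    rw [mem_coe, mem_St h.hp] at hg
    simp only [coe_filter, mem_univ, true_and, Set.mem_ofPred_eq]
    constructor
    · intro a b hab
      have := hg.1.1 _ (hidx1 a) _ (hidx1 b) hab
      rw [← hidx2 a, this, hidx2 b]
    · intro a b hab
      obtain ⟨i, hi, hs⟩ := ord_edges hT h hc hab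
      have hpi := h.hp i
      have hadj := hg.1.2 i hi
      rw [Sym2.eq_iff] at hs
      rcases hs with ⟨rfl, rfl⟩ | ⟨rfl, rfl⟩
      · rw [hidx3 _ (by omega), hidx3 _ (by omega)]; exact hadj
      · rw [hidx3 _ (by omega), hidx3 _ (by omega)]; exact hadj.symm
  · intro f hf
    funext a
    simp only [if_pos (hidx1 a), hidx2]
  · intro g hg
    rw [mem_coe, mem_St h.hp] at hg
    funext l
    dsimp only
    split_ifs with hl
    · rw [hidx3 l hl]
    · rw [hidx3 0 (by omega), hg.2 l (by omega)]

lemma dg_eq (v : β) : dg G v = (G.degree v : ℝ) := by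
  unfold dg nb
  rw [← SimpleGraph.card_neighborFinset_eq_degree]
  congr 2
  ext u; simp

lemma edges_eq : (Nat.card G.edgeSet : ℝ) = (#G.edgeFinset : ℝ) := by
  rw [Nat.card_eq_fintype_card, SimpleGraph.edgeFinset_card]

lemma sum_dg : ∑ v, dg G v = 2 * (Nat.card G.edgeSet : ℝ) := by
  simp only [dg_eq]
  rw [edges_eq]
  exact_mod_cast G.sum_degrees_eq_twice_card_edges

lemma sum_dg' (hn : 0 < Fintype.card β) : ∑ v, dg G v = (Fintype.card β : ℝ) * avgDeg G := by
  rw [sum_dg]; unfold avgDeg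
  have : (Fintype.card β : ℝ) ≠ 0 := by positivity
  field_simp

lemma card_pos_of (h : 0 < avgDeg G) : 0 < Fintype.card β := by
  by_contra hn
  have : Fintype.card β = 0 := by omega
  unfold avgDeg at h
  rw [this] at h
  simp at h

lemma induce_edges (v : β) : (Nat.card (G.induce {v}ᶜ).edgeSet : ℝ) =
    (Nat.card G.edgeSet : ℝ) - dg G v := by
  rw [edges_eq, edges_eq, dg_eq]
  have h1 := SimpleGraph.card_edgeFinset_induce_compl_singleton G v
  have h2 := SimpleGraph.card_edgeFinset_deleteIncidenceSet G v
  have h3 := SimpleGraph.degree_le_card_edgeFinset (G := G) (v := v)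
  rw [eq_sub_iff_add_eq]
  have h4 := Nat.sub_add_cancel h3
  rw [← h2, ← h1] at h4
  rw [← h4]
  push_cast
  congr!

lemma monCount_induce {α : Type} [Fintype α] (T : SimpleGraph α) (G : SimpleGraph β) (s : Set β) :
    monCount T (G.induce s) ≤ monCount T G := by
  unfold monCount
  apply Nat.card_le_card_of_injective
    (fun f => ⟨fun a => (f.1 a : β), fun a b hab => f.2.1 (Subtype.ext hab),
      fun a b hab => f.2.2 hab⟩)
  intro f g hfg
  apply Subtype.ext
  funext a
  have := congrFun (congrArg Subtype.val hfg) a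
  exact Subtype.ext this

lemma prod_mono (t : ℕ) (d d' : ℝ) (h0 : (t:ℝ) < d) (h : d ≤ d') :
    (d' / d) ^ t * ∏ i ∈ range t, (d - (i:ℝ)) ≤ ∏ i ∈ range t, (d' - (i:ℝ)) := by
  have ht : (0:ℝ) ≤ t := by positivity
  have : (d' / d) ^ t = ∏ i ∈ range t, (d' / d) := by
    rw [prod_const, card_range]
  rw [this, ← prod_mul_distrib]
  apply prod_le_prod
  · intro i hi
    have : (i:ℝ) ≤ t := by exact_mod_cast (mem_range.1 hi).le
    exact mul_nonneg (div_nonneg (by linarith) (by linarith)) (by linarith)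
  · intro i hi
    have : (0:ℝ) ≤ i := by positivity
    rw [div_mul_eq_mul_div, div_le_iff₀ (by linarith)]
    nlinarith

lemma induct {α : Type} [Fintype α] {T : SimpleGraph α} (hT : T.IsTree) {p : ℕ → ℕ} {e : ℕ → α}
    {t : ℕ} (h : Ord T p e t) (hc : Fintype.card α = t + 1) (ht : 3 ≤ t) (n : ℕ) :
    ∀ (β : Type) [Fintype β] (G : SimpleGraph β), Fintype.card β = n → D0 t ≤ avgDeg G →
    (Fintype.card β : ℝ) * fallFact (avgDeg G) t < monCount T G ∨
    ((Fintype.card β : ℝ) * fallFact (avgDeg G) t ≤ monCount T G ∧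
      (∀ v, dg G v = avgDeg G) ∧ ∀ u v w, G.Adj u v → G.Adj u w → v ≠ w → G.Adj v w) := by
  induction n with
  | zero =>
    intro β _ G hn hd
    exfalso
    have : avgDeg G = 0 := by unfold avgDeg; rw [hn]; simp
    rw [this] at hd
    unfold D0 at hd
    have := Kc_nonneg t t
    have : 0 < 16 * ((t : ℝ) + 1) + 80 * t * Kc t t * (4 * t * Kc t t + 1) := by positivity
    linarith
  | succ n ih =>
    intro β _ G hn hd
    have hD : 16 * ((t : ℝ) + 1) ≤ avgDeg G := by
      have h1 := Kc_nonneg t t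
      have : 0 ≤ 80 * t * Kc t t * (4 * t * Kc t t + 1) := by positivity
      unfold D0 at hd
      linarith
    have ht0 : (3:ℝ) ≤ t := by exact_mod_cast ht
    set d := avgDeg G with hdd
    have hM := sum_dg' (G := G) (by omega)
    rw [← hdd] at hM
    by_cases hmin : ∀ v, d / 4 ≤ dg G v
    · have H : Hyp t d G p := ⟨h.hp, hD, hmin, hM, by omega⟩
      rw [monCount_eq hT h hc G]
      exact H.final hd ht h.hp2 h.hp3
    · left
      push Not at hmin
      obtain ⟨v, hv⟩ := hmin
      set G' := G.induce {v}ᶜ with hG'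
      have hcard : Fintype.card ({v}ᶜ : Set β) = n := by
        rw [Fintype.card_compl_set]; simp [hn]
      have hE := induce_edges (G := G) v
      have hS := sum_dg (G := G)
      rw [hM, hn] at hS
      push_cast at hS
      rcases Nat.eq_zero_or_pos n with rfl | hnpos
      · exfalso
        have : ∀ u, u = v := by
          intro u
          have := Fintype.card_le_one_iff.1 (by omega : Fintype.card β ≤ 1)
          exact this u v
        have h0 : dg G v = 0 := by
          unfold dg nb
          norm_cast
          rw [card_eq_zero, filter_eq_empty_iff]
          intro u _ hu
          rw [this u] at hu
          exact G.irrefl hu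
        have : ∑ u, dg G u = 0 := by
          apply sum_eq_zero
          intro u _
          rw [this u, h0]
        rw [this, hn] at hM
        push_cast at hM
        linarith
      have hn0 : (0:ℝ) < n := by exact_mod_cast hnpos
      have hd' : avgDeg G' = ((n + 1) * d - 2 * dg G v) / n := by
        unfold avgDeg
        rw [hE, hcard, hS]
        ring
      set d' := avgDeg G' with hdd'
      have hge : d * (1 + 1 / (2 * n)) ≤ d' := by
        rw [hd', le_div_iff₀ hn0]
        have : d * (1 + 1 / (2 * n)) * n = d * n + d / 2 := by field_simp
        rw [this]; linarith
      have hpos1 : (0:ℝ) ≤ 1 / (2 * n) := by positivity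
      have hdpos : 0 < d := by linarith
      have hge2 : d ≤ d' := by nlinarith
      have hind : (n : ℝ) * fallFact d' t ≤ monCount T G' := by
        have := ih _ G' hcard (hd.trans hge2)
        rw [hcard] at this
        rcases this with h1 | h1
        · exact h1.le
        · exact h1.1
      have hle : (monCount T G' : ℝ) ≤ monCount T G := by
        exact_mod_cast monCount_induce T G _
      refine lt_of_lt_of_le ?_ (hind.trans hle)
      have hp := prod_mono t d d' (by linarith) hge2
      have hpp : 0 < ∏ i ∈ range t, (d - (i:ℝ)) := by
        apply prod_pos
        intro i hi
        have : (i:ℝ) ≤ t := by exact_mod_cast (mem_range.1 hi).le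
        linarith
      have hb : 1 + t * (1 / (2 * n)) ≤ (d' / d) ^ t := by
        have h1 := one_add_mul_le_pow (a := 1 / (2 * (n:ℝ))) (by linarith) t
        refine h1.trans ?_
        apply pow_le_pow_left₀ (by linarith)
        rw [le_div_iff₀ hdpos]; linarith
      unfold fallFact
      have h3 : (1 + t * (1 / (2 * n))) * ∏ i ∈ range t, (d - (i:ℝ)) ≤ ∏ i ∈ range t, (d' - (i:ℝ)) :=
        (mul_le_mul_of_nonneg_right hb hpp.le).trans hp
      have h4 := mul_le_mul_of_nonneg_left h3 hn0.le
      refine lt_of_lt_of_le ?_ h4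
      have h5 : (n:ℝ) * ((1 + t * (1 / (2 * n))) * ∏ i ∈ range t, (d - (i:ℝ))) =
        (n + t / 2) * ∏ i ∈ range t, (d - (i:ℝ)) := by field_simp
      rw [h5, hn]
      push_cast
      apply mul_lt_mul_of_pos_right _ hpp
      linarith

lemma adj_of_walk (htr : ∀ u v w, G.Adj u v → G.Adj u w → v ≠ w → G.Adj v w) {a b : β}
    (w : G.Walk a b) : a = b ∨ G.Adj a b := by
  induction w with
  | nil => left; rfl
  | cons h q ih =>
    rename_i x y z
    rcases ih with rfl | hyz
    · right; exact h
    · by_cases hxz : x = z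
      · left; exact hxz
      · right; exact htr y x z h.symm hyz hxz

lemma cliques_of (htr : ∀ u v w, G.Adj u v → G.Adj u w → v ≠ w → G.Adj v w) {k : ℕ}
    (hk : ∀ v, dg G v = k) : componentsAreCliques G (k + 1) := by
  intro c
  induction c using SimpleGraph.ConnectedComponent.ind with
  | _ v =>
  constructor
  · have : (G.connectedComponentMk v).supp = ((insert v (nb G v) : Finset β) : Set β) := by
      ext u
      rw [SimpleGraph.ConnectedComponent.mem_supp_iff, SimpleGraph.ConnectedComponent.eq]
      simp only [coe_insert, Set.mem_insert_iff, mem_coe, nb, mem_filter, mem_univ, true_and]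
      constructor
      · rintro ⟨w⟩
        rcases adj_of_walk htr w with h | h
        · left; exact h
        · right; exact h.symm
      · rintro (rfl | h)
        · exact SimpleGraph.Reachable.refl _
        · exact h.symm.reachable
    rw [this, Set.ncard_coe_finset, card_insert_of_notMem (by simp [nb])]
    have := hk v
    unfold dg at this
    have : #(nb G v) = k := by exact_mod_cast this
    rw [this]
  · intro a ha b hb hab
    rw [SimpleGraph.ConnectedComponent.mem_supp_iff] at ha hb
    obtain ⟨w⟩ := SimpleGraph.ConnectedComponent.exact (ha.trans hb.symm)
    exact (adj_of_walk htr w).resolve_left hab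

lemma count_cliques (hp : ∀ k, p (k + 1) ≤ k) {k : ℕ} (hcl : componentsAreCliques G (k + 1))
    (j : ℕ) : Nx G p j (fun _ => 1) =
      (Fintype.card β : ℝ) * ∏ i ∈ range j, ((k : ℝ) - i) := by
  have hadj : ∀ a b, G.Reachable a b → a ≠ b → G.Adj a b := by
    intro a b hab hne
    refine (hcl (G.connectedComponentMk a)).2 ?_ ?_ hne
    · rw [SimpleGraph.ConnectedComponent.mem_supp_iff]
    · rw [SimpleGraph.ConnectedComponent.mem_supp_iff, SimpleGraph.ConnectedComponent.eq]
      exact hab.symm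
  have hdeg : ∀ v, dg G v = k := by
    intro v
    have h1 := (hcl (G.connectedComponentMk v)).1
    have : (G.connectedComponentMk v).supp = ((insert v (nb G v) : Finset β) : Set β) := by
      ext u
      rw [SimpleGraph.ConnectedComponent.mem_supp_iff, SimpleGraph.ConnectedComponent.eq]
      simp only [coe_insert, Set.mem_insert_iff, mem_coe, nb, mem_filter, mem_univ, true_and]
      constructor
      · intro h
        by_cases hu : u = v
        · left; exact hu
        · right; exact (hadj u v h hu).symm
      · rintro (rfl | h)
        · exact SimpleGraph.Reachable.refl _
        · exact h.symm.reachable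
    rw [this, Set.ncard_coe_finset, card_insert_of_notMem (by simp [nb])] at h1
    unfold dg
    have : #(nb G v) = k := by omega
    rw [this]
  induction j with
  | zero => simp [Nx, Op]
  | succ j ih =>
    have h1 : Nx G p (j + 1) (fun _ => 1) = Nx G p j (fun _ => ((k:ℝ) - j) * 1) := by
      show Op G p _ _ (j + 1) _ = _
      simp only [Op]
      apply op_congr hp
      intro f hf
      have hreach : ∀ i ≤ j, G.Reachable (f 0) (f i) := by
        intro i
        induction i using Nat.strong_induction_on with
        | _ i ihi =>
          intro hi
          rcases i with _ | i
          · exact SimpleGraph.Reachable.refl _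
          · have := hp i
            exact (ihi (p (i + 1)) (by omega) (by omega)).trans (hf.2 i (by omega)).reachable
      have hus : us G p j f = (range (j + 1)).erase (p (j + 1)) := by
        apply Subset.antisymm (us_subset hp j f)
        intro l hl
        rw [mem_erase, mem_range] at hl
        have hpj := hp j
        simp only [us, mem_filter, mem_range]
        refine ⟨hl.2, hadj _ _ ((hreach _ hpj).symm.trans (hreach l (by omega))) ?_⟩
        intro heq
        exact hl.1 (hf.1 _ hpj _ (by omega) heq).symm
      have hav := av_eq hf
      rw [hus, card_erase_of_mem (mem_range.2 (by have := hp j; omega)), card_range, hdeg] at hav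
      simp only [Nat.add_sub_cancel] at hav
      simp only [sum_const, nsmul_eq_mul, mul_one, one_mul]
      exact hav
    rw [h1]
    have h2 : Nx G p j (fun _ => ((k:ℝ) - j) * 1) = ((k:ℝ) - j) * Nx G p j (fun _ => 1) :=
      op_smul j _ _
    rw [h2, ih, prod_range_succ]; ring

end TreeCount

theorem tree_count_equality_iff_cliques (t : ℕ) (ht : 0 < t) :
    ∃ d0 : ℝ, ∀ (α β : Type) [Fintype α] [Fintype β]
      (T : SimpleGraph α) (G : SimpleGraph β),
      T.IsTree → Fintype.card α = t + 1 →
      (∃ u v : α, 3 ≤ T.dist u v) →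
      d0 ≤ avgDeg G →
      ((monCount T G : ℝ) = (Fintype.card β : ℝ) * fallFact (avgDeg G) t ↔
        ∃ k : ℕ, (k : ℝ) = avgDeg G ∧ componentsAreCliques G (k + 1)) := by
  refine ⟨TreeCount.D0 t, ?_⟩
  intro α β _ _ T G hT hc hdist hd
  obtain ⟨ht3, p, e, ho⟩ := TreeCount.ord_exists T hT hc hdist
  constructor
  · intro heq
    rcases TreeCount.induct hT ho hc ht3 _ β G rfl hd with h | ⟨_, hreg, htr⟩
    · exact absurd heq h.ne'
    · have hpos : 0 < avgDeg G := by
        have h1 := TreeCount.Kc_nonneg t t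
        have : 0 < TreeCount.D0 t := by unfold TreeCount.D0; positivity
        linarith
      have hn := TreeCount.card_pos_of hpos
      obtain ⟨v⟩ := Fintype.card_pos_iff.1 hn
      refine ⟨(TreeCount.nb G v).card, hreg v, TreeCount.cliques_of htr fun u => ?_⟩
      rw [hreg u, ← hreg v]
      rfl
  · rintro ⟨k, hk, hcl⟩
    rw [TreeCount.monCount_eq hT ho hc G, TreeCount.count_cliques ho.hp hcl, ← hk]
    rfl
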